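/- arXiv:2601.04612 — 2 statements merged into one kernel-verified Lean document; each statement's English description precedes it below -/
import Mathlib

section
/- Let X be a Banach space, and let F : [0, ∞) → L(X) satisfy F(0) = I, ‖F(t)^n‖ ≤ K e^{ant} for all n ∈ ℕ, t ≥ 0 (with K ≥ 1, a ∈ ℝ), and suppose there is a dense subspace D ⊆ X such that the limit F′(0)y := lim_{t→0⁺} (F(t)y − y)/t exists for all y ∈ D, and (λ − F′(0))D is dense in X for some λ > a. Then F′(0) is closable, its closure generates a strongly continuous semigroup (e^{F′(0)t})_{t≥0}, and for every x ∈ X and T > 0, sup_{t∈[0,T]} ‖(e^{F′(0)t} − F(t/n)^n)x‖ → 0 as n → ∞. -/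
open Set Filter

section PowerBounded

variable {X : Type*} [NormedAddCommGroup X] [NormedSpace ℝ X]

theorem norm_pow_apply_sub_pow_apply_le {U V : X →L[ℝ] X} (hUV : Commute U V) {C : ℝ}
    (hC : ∀ i j : ℕ, ‖U ^ i * V ^ j‖ ≤ C) (n : ℕ) (x : X) :
    ‖(U ^ n) x - (V ^ n) x‖ ≤ n * (C * ‖U x - V x‖) := by
  have h := congrArg (fun W : X →L[ℝ] X => W x) (hUV.geom_sum₂_mul n)
  simp only [sub_apply, mul_apply_eq_comp,
    sum_apply] at h
  rw [← h]
  refine (norm_sum_le_of_le (f := fun i => (U ^ i) ((V ^ (n - 1 - i)) (U x - V x)))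
    (n := fun _ => C * ‖U x - V x‖) _ fun i _ => ?_).trans (by simp)
  exact (U ^ i * V ^ (n - 1 - i)).le_of_opNorm_le (hC _ _) _

theorem norm_pow_apply_sub_self_le {T : X →L[ℝ] X} {K : ℝ} (hT : ∀ n : ℕ, ‖T ^ n‖ ≤ K)
    (n : ℕ) (x : X) : ‖(T ^ n) x - x‖ ≤ n * (K * ‖T x - x‖) := by
  simpa using norm_pow_apply_sub_pow_apply_le (Commute.one_right T) (C := K)
    (by simpa using hT) n x

theorem isUnit_one_sub_smul_of_norm_pow_le [CompleteSpace X] {T : X →L[ℝ] X} {K : ℝ}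
    (hT : ∀ n : ℕ, ‖T ^ n‖ ≤ K) {q : ℝ} (hq : |q| < 1) : IsUnit (1 - q • T) := by
  have hlim : Tendsto (fun n : ℕ => |q| ^ n * K) atTop (nhds 0) := by
    simpa using (tendsto_pow_atTop_nhds_zero_of_lt_one (abs_nonneg q) hq).mul_const K
  obtain ⟨n, hn⟩ := (hlim.eventually (gt_mem_nhds one_pos)).exists
  have hunit : IsUnit (1 - (q • T) ^ n) := by
    refine isUnit_one_sub_of_norm_lt_one (lt_of_le_of_lt ?_ hn)
    rw [smul_pow, norm_smul, norm_pow, Real.norm_eq_abs]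
    gcongr
    exact hT n
  rw [← mul_neg_geom_sum] at hunit
  refine (Commute.isUnit_mul_iff ?_).1 hunit |>.1
  exact Commute.sum_right _ _ _ fun i _ =>
    ((Commute.one_left _).sub_left (Commute.refl _)).pow_right i

/-- The backward Euler step of size `s` for the bounded generator `B`. -/
noncomputable def backwardEuler (B : X →L[ℝ] X) (s : ℝ) : X →L[ℝ] X :=
  Ring.inverse (1 - s • B)

theorem norm_pow_one_add_smul_apply_sub_le {B : X →L[ℝ] X} {h K : ℝ} (hh : 0 ≤ h)
    (hB : ∀ n : ℕ, ‖(1 + h • B) ^ n‖ ≤ K) (n : ℕ) (x : X) :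
    ‖((1 + h • B) ^ n) x - x‖ ≤ n * h * (K * ‖B x‖) := by
  refine (norm_pow_apply_sub_self_le hB n x).trans (le_of_eq ?_)
  simp [norm_smul, abs_of_nonneg hh]
  ring

theorem norm_pow_one_add_smul_apply_sub_sub_le {B : X →L[ℝ] X} {h K : ℝ} (hh : 0 ≤ h)
    (hB : ∀ n : ℕ, ‖(1 + h • B) ^ n‖ ≤ K) (n : ℕ) (x w : X) :
    ‖((1 + h • B) ^ n) x - x - ((n : ℝ) * h) • B x‖ ≤
      n * h * ((K + 1) * ‖B x - w‖ + K * (n * h) * ‖B w‖) := by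
  have hK : 0 ≤ K := (norm_nonneg _).trans (hB 0)
  have hsum := congrArg (fun W : X →L[ℝ] X => W x) (geom_sum_mul (1 + h • B) n)
  simp only [sub_apply, mul_apply_eq_comp,
    sum_apply, add_sub_cancel_left, one_apply_eq_self,
    smul_apply] at hsum
  have hconst : ((n : ℝ) * h) • B x = ∑ i ∈ Finset.range n, h • B x := by
    simp [mul_smul, ← Nat.cast_smul_eq_nsmul ℝ]
  rw [← hsum, hconst, ← Finset.sum_sub_distrib]
  refine (norm_sum_le_of_le (n := fun _ => h * ((K + 1) * ‖B x - w‖ + K * (n * h) * ‖B w‖)) _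
    fun i hi => ?_).trans (by simp [mul_assoc])
  have hi' : (i : ℝ) ≤ n := by exact_mod_cast (Finset.mem_range.1 hi).le
  rw [map_smul, ← smul_sub, norm_smul, Real.norm_eq_abs, abs_of_nonneg hh]
  gcongr
  have hsplit : ((1 + h • B) ^ i) (B x) - B x =
      ((1 + h • B) ^ i) (B x - w) + (((1 + h • B) ^ i) w - w) - (B x - w) := by
    rw [map_sub]; abel
  rw [hsplit]
  refine (norm_sub_le _ _).trans ?_
  have h1 := norm_add_le (((1 + h • B) ^ i) (B x - w)) (((1 + h • B) ^ i) w - w)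
  have h2 := ((1 + h • B) ^ i).le_of_opNorm_le (hB i) (B x - w)
  have h3 := norm_pow_one_add_smul_apply_sub_le hh hB i w
  have h4 : i * h * (K * ‖B w‖) ≤ n * h * (K * ‖B w‖) := by gcongr
  linarith

section BackwardEuler

variable [CompleteSpace X] {B : X →L[ℝ] X} {h K s : ℝ}

theorem isUnit_one_sub_smul_of_norm_pow_one_add_smul_le (hh : 0 < h)
    (hB : ∀ n : ℕ, ‖(1 + h • B) ^ n‖ ≤ K) (hs : 0 ≤ s) : IsUnit (1 - s • B) := by
  have hpos : 0 < 1 + s / h := by positivity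
  have hq : |s / h / (1 + s / h)| < 1 := by
    rw [abs_of_nonneg (by positivity), div_lt_one hpos]; linarith
  have := (isUnit_one_sub_smul_of_norm_pow_le hB hq).smul (Units.mk0 _ hpos.ne')
  convert! this using 1
  ext x
  simp [Units.smul_def, smul_sub, smul_smul]
  have e1 : (1 + s / h) * (s / h / (1 + s / h)) = s / h := by field_simp
  have e2 : (1 + s / h) * (s / h / (1 + s / h) * h) = s := by field_simp
  simp only [e1, e2, add_smul, one_smul]
  abel

variable (hh : 0 < h) (hB : ∀ n : ℕ, ‖(1 + h • B) ^ n‖ ≤ K) (hs : 0 ≤ s)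
include hh hB hs

theorem one_sub_smul_mul_backwardEuler : (1 - s • B) * backwardEuler B s = 1 :=
  Ring.mul_inverse_cancel _ (isUnit_one_sub_smul_of_norm_pow_one_add_smul_le hh hB hs)

theorem backwardEuler_mul_one_sub_smul : backwardEuler B s * (1 - s • B) = 1 :=
  Ring.inverse_mul_cancel _ (isUnit_one_sub_smul_of_norm_pow_one_add_smul_le hh hB hs)

theorem commute_backwardEuler {C : X →L[ℝ] X} (hC : Commute C B) :
    Commute C (backwardEuler B s) := by
  have hc : C * (1 - s • B) = (1 - s • B) * C :=
    ((Commute.one_right C).sub_right (hC.smul_right s)).eq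
  calc C * backwardEuler B s
      = backwardEuler B s * (1 - s • B) * C * backwardEuler B s := by
        rw [backwardEuler_mul_one_sub_smul hh hB hs, one_mul]
    _ = backwardEuler B s * (C * (1 - s • B)) * backwardEuler B s := by
        rw [hc]; simp only [mul_assoc]
    _ = backwardEuler B s * C * ((1 - s • B) * backwardEuler B s) := by simp only [mul_assoc]
    _ = backwardEuler B s * C := by rw [one_sub_smul_mul_backwardEuler hh hB hs, mul_one]

theorem norm_pow_mul_backwardEuler_pow_le (k n : ℕ) :
    ‖(1 + h • B) ^ k * backwardEuler B s ^ n‖ ≤ K := by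
  set T := 1 + h • B with hTdef
  set J := backwardEuler B s with hJ
  have hc : 0 ≤ s / h := by positivity
  have hTJ : (1 + s / h) • J = 1 + (s / h) • (T * J) := by
    have h1 := one_sub_smul_mul_backwardEuler hh hB hs
    rw [← hJ] at h1
    have e : s / h * h = s := by field_simp
    calc (1 + s / h) • J = (1 - s • B) * J + (s / h) • (T * J) := by
          rw [hTdef]
          simp only [sub_mul, add_mul, one_mul, smul_mul_assoc, smul_add, add_smul, one_smul,
            smul_smul, e]
          abel
      _ = _ := by rw [h1]
  induction n generalizing k with
  | zero => simpa using hB k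
  | succ n ih =>
    have hbdd : BddAbove (range fun k : ℕ => ‖T ^ k * J ^ (n + 1)‖) := by
      refine ⟨K * ‖J ^ (n + 1)‖, ?_⟩
      rintro _ ⟨k, rfl⟩
      exact (norm_mul_le _ _).trans (by gcongr; exact hB k)
    have hstep : ∀ k : ℕ, (1 + s / h) * ‖T ^ k * J ^ (n + 1)‖ ≤
        K + s / h * ⨆ k : ℕ, ‖T ^ k * J ^ (n + 1)‖ := by
      intro k
      have e : (1 + s / h) • (T ^ k * J ^ (n + 1)) =
          T ^ k * J ^ n + (s / h) • (T ^ (k + 1) * J ^ (n + 1)) := by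
        have hcomm : Commute T (J ^ n) := ((commute_backwardEuler hh hB hs
          ((Commute.one_left B).add_left ((Commute.refl B).smul_left h))).pow_right n)
        rw [pow_succ J, ← mul_assoc, ← mul_smul_comm, hTJ, mul_add, mul_one, mul_smul_comm]
        congr 2
        rw [pow_succ T, mul_assoc, mul_assoc, ← mul_assoc (J ^ n), ← hcomm.eq,
          mul_assoc]
      have hn := congrArg norm e
      rw [norm_smul, Real.norm_eq_abs, abs_of_nonneg (by positivity)] at hn
      rw [hn]
      refine (norm_add_le _ _).trans (add_le_add (ih k) ?_)
      rw [norm_smul, Real.norm_eq_abs, abs_of_nonneg hc]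
      gcongr
      exact le_ciSup hbdd (k + 1)
    have hsup : (1 + s / h) * ⨆ k : ℕ, ‖T ^ k * J ^ (n + 1)‖ ≤
        K + s / h * ⨆ k : ℕ, ‖T ^ k * J ^ (n + 1)‖ := by
      rw [Real.mul_iSup_of_nonneg (by positivity)]
      exact ciSup_le hstep
    exact (le_ciSup hbdd k).trans (by linarith)

theorem norm_backwardEuler_pow_le (n : ℕ) : ‖backwardEuler B s ^ n‖ ≤ K := by
  simpa using norm_pow_mul_backwardEuler_pow_le hh hB hs 0 n

theorem norm_backwardEuler_le : ‖backwardEuler B s‖ ≤ K := by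
  simpa using norm_backwardEuler_pow_le hh hB hs 1

theorem smul_apply_backwardEuler (x : X) :
    s • B (backwardEuler B s x) = backwardEuler B s x - x := by
  have := congrArg (fun W : X →L[ℝ] X => W x) (one_sub_smul_mul_backwardEuler hh hB hs)
  simp only [mul_apply_eq_comp, sub_apply, one_apply_eq_self, smul_apply] at this
  rw [sub_eq_iff_eq_add, add_comm] at this
  exact eq_sub_of_add_eq this.symm

theorem backwardEuler_apply_sub_smul (x : X) :
    backwardEuler B s (x - s • B x) = x := by
  have := congrArg (fun W : X →L[ℝ] X => W x) (backwardEuler_mul_one_sub_smul hh hB hs)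
  simpa using this

theorem apply_backwardEuler (x : X) : B (backwardEuler B s x) = backwardEuler B s (B x) :=
  congrArg (fun W : X →L[ℝ] X => W x) (commute_backwardEuler hh hB hs (Commute.refl B)).eq

theorem norm_apply_backwardEuler_le (hs' : 0 < s) (x : X) :
    ‖B (backwardEuler B s x)‖ ≤ s⁻¹ * ((K + 1) * ‖x‖) := by
  have h1 : B (backwardEuler B s x) = s⁻¹ • (backwardEuler B s x - x) := by
    rw [← smul_apply_backwardEuler hh hB hs, inv_smul_smul₀ hs'.ne']
  rw [h1, norm_smul, Real.norm_eq_abs, abs_of_pos (inv_pos.2 hs')]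
  gcongr
  refine (norm_sub_le _ _).trans ?_
  have := (backwardEuler B s).le_of_opNorm_le (norm_backwardEuler_le hh hB hs) x
  linarith

theorem norm_backwardEuler_apply_sub_le (x : X) :
    ‖backwardEuler B s x - x - s • B x‖ ≤ s ^ 2 * (K * ‖B (B x)‖) := by
  have e : backwardEuler B s x - x - s • B x = s ^ 2 • backwardEuler B s (B (B x)) := by
    rw [← smul_apply_backwardEuler hh hB hs x, ← smul_sub, apply_backwardEuler hh hB hs,
      ← smul_apply_backwardEuler hh hB hs (B x), apply_backwardEuler hh hB hs, smul_smul, sq]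
  rw [e, norm_smul, Real.norm_eq_abs, abs_of_nonneg (by positivity)]
  gcongr
  exact (backwardEuler B s).le_of_opNorm_le (norm_backwardEuler_le hh hB hs) _

theorem norm_pow_sub_backwardEuler_pow_le (m n : ℕ) (x : X) :
    ‖((1 + h • B) ^ (m * n)) x - (backwardEuler B s ^ n) x‖ ≤
      n * (K * (((m * h) ^ 2 + s ^ 2) * (K * ‖B (B x)‖) + |m * h - s| * ‖B x‖)) := by
  have hK : 0 ≤ K := (norm_nonneg _).trans (hB 0)
  have hcomm : Commute ((1 + h • B) ^ m) (backwardEuler B s) :=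
    (commute_backwardEuler hh hB hs
      ((Commute.one_left B).add_left ((Commute.refl B).smul_left h))).pow_left m
  rw [pow_mul]
  refine (norm_pow_apply_sub_pow_apply_le hcomm (C := K) (fun i j => ?_) n x).trans ?_
  · rw [← pow_mul]
    exact norm_pow_mul_backwardEuler_pow_le hh hB hs _ _
  gcongr
  have e : ((1 + h • B) ^ m) x - backwardEuler B s x =
      (((1 + h • B) ^ m) x - x - ((m : ℝ) * h) • B x) - (backwardEuler B s x - x - s • B x)
        + (m * h - s) • B x := by
    rw [sub_smul]; abel
  rw [e]
  refine (norm_add_le _ _).trans (add_le_add ((norm_sub_le _ _).trans ?_) ?_)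
  · have h1 := norm_pow_one_add_smul_apply_sub_sub_le hh.le hB m x (B x)
    have h2 := norm_backwardEuler_apply_sub_le hh hB hs x
    simp only [sub_self, norm_zero, mul_zero, zero_add] at h1
    linarith
  · rw [norm_smul, Real.norm_eq_abs]

end BackwardEuler

end PowerBounded

section StrongLimits

variable {ι X : Type*} [NormedAddCommGroup X] [NormedSpace ℝ X] {l : Filter ι}
  {B : ι → X →L[ℝ] X} {L : X →L[ℝ] X} {K : ℝ}

theorem tendsto_apply_of_norm_le (hB : ∀ᶠ i in l, ‖B i‖ ≤ K)
    (hL : ∀ z, Tendsto (fun i => B i z) l (nhds (L z))) {v : ι → X} {w : X}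
    (hv : Tendsto v l (nhds w)) : Tendsto (fun i => B i (v i)) l (nhds (L w)) := by
  have hzero : Tendsto (fun i => B i (v i - w)) l (nhds 0) := by
    have hlim : Tendsto (fun i => K * ‖v i - w‖) l (nhds 0) := by
      simpa using ((tendsto_sub_nhds_zero_iff.2 hv).norm).const_mul K
    exact squeeze_zero_norm' (hB.mono fun i hi => (B i).le_of_opNorm_le hi _) hlim
  simpa using hzero.add (hL w)

theorem tendsto_pow_apply_of_norm_le (hB : ∀ᶠ i in l, ‖B i‖ ≤ K)
    (hL : ∀ z, Tendsto (fun i => B i z) l (nhds (L z))) (n : ℕ) {v : ι → X} {w : X}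
    (hv : Tendsto v l (nhds w)) : Tendsto (fun i => (B i ^ n) (v i)) l (nhds ((L ^ n) w)) := by
  induction n with
  | zero => simpa using hv
  | succ n ih => simpa only [pow_succ', mul_apply_eq_comp] using tendsto_apply_of_norm_le hB hL ih

theorem exists_tendsto_of_forall_eventually_norm_sub_lt {ι X : Type*} [NormedAddCommGroup X]
    [CompleteSpace X] {l : Filter ι} [l.NeBot] {f : ι → X}
    (hf : ∀ ε > 0, ∃ v, ∀ᶠ i in l, ‖f i - v‖ < ε) : ∃ w, Tendsto f l (nhds w) := by
  rw [← cauchy_map_iff_exists_tendsto, Metric.cauchy_iff]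
  refine ⟨inferInstance, fun ε hε => ?_⟩
  obtain ⟨v, hv⟩ := hf (ε / 2) (half_pos hε)
  refine ⟨Metric.ball v (ε / 2), mem_map.2 (hv.mono fun i hi => by
    simpa [dist_eq_norm] using hi), fun x hx y hy => ?_⟩
  have := dist_triangle_right x y v
  rw [Metric.mem_ball] at hx hy
  linarith

theorem exists_continuousLinearMap_tendsto_of_dense [CompleteSpace X] [l.NeBot]
    (hB : ∀ᶠ i in l, ‖B i‖ ≤ K) {s : Set X}
    (hs : Dense s) (h : ∀ z ∈ s, ∃ w, Tendsto (fun i => B i z) l (nhds w)) :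
    ∃ L : X →L[ℝ] X, ∀ z, Tendsto (fun i => B i z) l (nhds (L z)) := by
  have hK : 0 ≤ K := by
    obtain ⟨i, hi⟩ := hB.exists
    exact (norm_nonneg _).trans hi
  have hall : ∀ z, ∃ w, Tendsto (fun i => B i z) l (nhds w) := by
    intro z
    refine exists_tendsto_of_forall_eventually_norm_sub_lt fun ε hε => ?_
    obtain ⟨y, hy, hzy⟩ := Metric.dense_iff.1 hs z (ε / 2 / (K + 1)) (by positivity)
    obtain ⟨w, hw⟩ := h _ hzy
    refine ⟨w, ?_⟩
    filter_upwards [hB, Metric.tendsto_nhds.1 hw _ (half_pos hε)] with i hi hwi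
    rw [dist_eq_norm] at hwi
    have h1 : ‖B i (z - y)‖ ≤ ε / 2 := by
      refine ((B i).le_of_opNorm_le hi _).trans ?_
      rw [Metric.mem_ball, dist_comm, dist_eq_norm, lt_div_iff₀ (by positivity)] at hy
      nlinarith [norm_nonneg (z - y)]
    calc ‖B i z - w‖ = ‖B i (z - y) + (B i y - w)‖ := by rw [map_sub]; congr 1; abel
      _ ≤ ‖B i (z - y)‖ + ‖B i y - w‖ := norm_add_le _ _
      _ < ε := by linarith
  choose f hf using hall
  let L₀ : X →ₗ[ℝ] X := linearMapOfTendsto f (fun i => (B i : X →ₗ[ℝ] X))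
    (tendsto_pi_nhds.2 hf)
  exact ⟨L₀.mkContinuous K fun z => le_of_tendsto (hf z).norm
    (hB.mono fun i hi => (B i).le_of_opNorm_le hi z), hf⟩

end StrongLimits

/-- The filter of pairs `(h, k)` such that `h → 0⁺` and `k * h → t`. -/
def stepFilter (t : ℝ) : Filter (ℝ × ℕ) :=
  comap Prod.fst (nhdsWithin 0 (Ioi 0)) ⊓ comap (fun p => (p.2 : ℝ) * p.1) (nhds t)

section StepFilter

variable {t : ℝ}

theorem tendsto_fst_stepFilter : Tendsto Prod.fst (stepFilter t) (nhdsWithin 0 (Ioi 0)) :=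
  tendsto_comap.mono_left inf_le_left

theorem tendsto_mul_stepFilter :
    Tendsto (fun p : ℝ × ℕ => (p.2 : ℝ) * p.1) (stepFilter t) (nhds t) :=
  tendsto_comap.mono_left inf_le_right

theorem eventually_pos_stepFilter : ∀ᶠ p in stepFilter t, 0 < p.1 :=
  tendsto_fst_stepFilter.eventually self_mem_nhdsWithin

theorem tendsto_stepFilter_iff {ι : Type*} {l : Filter ι} {f : ι → ℝ × ℕ} :
    Tendsto f l (stepFilter t) ↔ Tendsto (fun i => (f i).1) l (nhdsWithin 0 (Ioi 0)) ∧
      Tendsto (fun i => ((f i).2 : ℝ) * (f i).1) l (nhds t) := by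
  rw [stepFilter, tendsto_inf, tendsto_comap_iff, tendsto_comap_iff]
  rfl

theorem tendsto_floor_mul_nhdsGT (ht : 0 ≤ t) :
    Tendsto (fun h : ℝ => (⌊t / h⌋₊ : ℝ) * h) (nhdsWithin 0 (Ioi 0)) (nhds t) := by
  have hid : Tendsto (fun h : ℝ => h) (nhdsWithin 0 (Ioi 0)) (nhds 0) :=
    tendsto_nhdsWithin_of_tendsto_nhds tendsto_id
  refine tendsto_of_tendsto_of_tendsto_of_le_of_le' (g := fun h => t - h) (h := fun _ => t)
    (by simpa using hid.const_sub t) tendsto_const_nhds ?_ ?_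
  · filter_upwards [self_mem_nhdsWithin] with h hh
    have := (Nat.lt_floor_add_one (t / h)).le
    rw [div_le_iff₀ hh] at this
    linarith
  · filter_upwards [self_mem_nhdsWithin] with h hh
    exact (le_div_iff₀ hh).1 (Nat.floor_le (div_nonneg ht hh.le))

theorem tendsto_floor_stepFilter (ht : 0 ≤ t) :
    Tendsto (fun h : ℝ => (h, ⌊t / h⌋₊)) (nhdsWithin 0 (Ioi 0)) (stepFilter t) :=
  tendsto_stepFilter_iff.2 ⟨tendsto_id, tendsto_floor_mul_nhdsGT ht⟩

theorem neBot_stepFilter (ht : 0 ≤ t) : (stepFilter t).NeBot :=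
  (tendsto_floor_stepFilter ht).neBot

theorem Filter.Eventually.eventually_stepFilter {P : ℝ × ℕ → Prop}
    (hP : ∀ᶠ p in stepFilter t, P p) : ∀ᶠ t' in nhds t, ∀ᶠ p in stepFilter t', P p := by
  obtain ⟨U, hU, V, hV, hUV⟩ := Filter.mem_inf_iff_superset.1 hP
  obtain ⟨W, hW, hWV⟩ := hV
  filter_upwards [eventually_mem_nhds_iff.2 hW] with t' ht'
  exact Filter.mem_inf_iff_superset.2
    ⟨U, hU, V, mem_of_superset (preimage_mem_comap ht') hWV, hUV⟩

theorem tendsto_div_mul_stepFilter {n : ℕ} (hn : 0 < n) :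
    Tendsto (fun p : ℝ × ℕ => ((p.2 / n : ℕ) : ℝ) * p.1) (stepFilter t) (nhds (t / n)) := by
  have hn' : (0 : ℝ) < n := by exact_mod_cast hn
  have h1 : Tendsto (fun p : ℝ × ℕ => ((p.2 / n : ℕ) : ℝ) * p.1 - (p.2 : ℝ) * p.1 / n)
      (stepFilter t) (nhds 0) := by
    have hfst : Tendsto (fun p : ℝ × ℕ => p.1) (stepFilter t) (nhds 0) :=
      tendsto_fst_stepFilter.mono_right nhdsWithin_le_nhds
    refine squeeze_zero_norm' ?_ hfst
    filter_upwards [eventually_pos_stepFilter] with p hp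
    have h2 : ((p.2 / n : ℕ) : ℝ) ≤ (p.2 : ℝ) / n := Nat.cast_div_le
    have h3 : (p.2 : ℝ) / n ≤ ((p.2 / n : ℕ) : ℝ) + 1 := by
      rw [div_le_iff₀ hn']
      exact_mod_cast (Nat.lt_mul_of_div_lt (Nat.lt_succ_self (p.2 / n)) hn).le
    rw [mul_div_right_comm, ← sub_mul, Real.norm_eq_abs, abs_mul, abs_of_pos hp]
    have : |((p.2 / n : ℕ) : ℝ) - (p.2 : ℝ) / n| ≤ 1 := by
      rw [abs_le]; constructor <;> linarith
    nlinarith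
  simpa using h1.add (tendsto_mul_stepFilter.div_const (n : ℝ))

end StepFilter

/-- The difference quotient `(F h - 1) / h`. -/
noncomputable def differenceQuotient {X : Type*} [NormedAddCommGroup X] [NormedSpace ℝ X]
    (F : ℝ → X →L[ℝ] X) (h : ℝ) : X →L[ℝ] X :=
  h⁻¹ • (F h - 1)

section Chernoff

variable {X : Type*} [NormedAddCommGroup X] [NormedSpace ℝ X] {F : ℝ → X →L[ℝ] X} {K : ℝ}
  {G : Set (X × X)}

theorem one_add_smul_differenceQuotient {h : ℝ} (hh : h ≠ 0) :
    1 + h • differenceQuotient F h = F h := by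
  rw [differenceQuotient, smul_smul, mul_inv_cancel₀ hh, one_smul, add_sub_cancel]

theorem norm_pow_differenceQuotient_le (hF : ∀ (n : ℕ) (t : ℝ), 0 ≤ t → ‖F t ^ n‖ ≤ K) {h : ℝ}
    (hh : 0 < h) (n : ℕ) : ‖(1 + h • differenceQuotient F h) ^ n‖ ≤ K := by
  rw [one_add_smul_differenceQuotient hh.ne']
  exact hF n h hh.le

variable [CompleteSpace X]

theorem eventually_norm_backwardEuler_le (hF : ∀ (n : ℕ) (t : ℝ), 0 ≤ t → ‖F t ^ n‖ ≤ K) {s : ℝ}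
    (hs : 0 ≤ s) :
    ∀ᶠ h in nhdsWithin 0 (Ioi 0), ‖backwardEuler (differenceQuotient F h) s‖ ≤ K := by
  filter_upwards [self_mem_nhdsWithin] with h hh
  exact norm_backwardEuler_le hh (norm_pow_differenceQuotient_le hF hh) hs

theorem tendsto_backwardEuler_sub_smul (hF : ∀ (n : ℕ) (t : ℝ), 0 ≤ t → ‖F t ^ n‖ ≤ K)
    (hG : ∀ p ∈ G, Tendsto (fun h => differenceQuotient F h p.1) (nhdsWithin 0 (Ioi 0))
      (nhds p.2)) {p : X × X} (hp : p ∈ G) {s : ℝ} (hs : 0 ≤ s) :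
    Tendsto (fun h => backwardEuler (differenceQuotient F h) s (p.1 - s • p.2))
      (nhdsWithin 0 (Ioi 0)) (nhds p.1) := by
  rw [← tendsto_sub_nhds_zero_iff]
  have hlim : Tendsto (fun h => K * ‖s • (differenceQuotient F h p.1 - p.2)‖)
      (nhdsWithin 0 (Ioi 0)) (nhds 0) := by
    simpa using (((tendsto_sub_nhds_zero_iff.2 (hG p hp)).const_smul s).norm).const_mul K
  refine squeeze_zero_norm' ?_ hlim
  filter_upwards [self_mem_nhdsWithin] with h hh
  have hB := norm_pow_differenceQuotient_le hF hh
  have e : backwardEuler (differenceQuotient F h) s (p.1 - s • p.2) - p.1 =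
      backwardEuler (differenceQuotient F h) s (s • (differenceQuotient F h p.1 - p.2)) := by
    nth_rewrite 2 [← backwardEuler_apply_sub_smul hh hB hs p.1]
    rw [← map_sub]
    congr 1
    rw [smul_sub]
    abel
  rw [e]
  exact (backwardEuler _ s).le_of_opNorm_le (norm_backwardEuler_le hh hB hs) _

/-- The backward Euler steps of size `s` for the difference quotients of `F` converge strongly. -/
def BackwardEulerConverges (F : ℝ → X →L[ℝ] X) (s : ℝ) : Prop :=
  ∃ L : X →L[ℝ] X, ∀ z, Tendsto (fun h => backwardEuler (differenceQuotient F h) s z)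
    (nhdsWithin 0 (Ioi 0)) (nhds (L z))

theorem backwardEulerConverges_of_dense (hF : ∀ (n : ℕ) (t : ℝ), 0 ≤ t → ‖F t ^ n‖ ≤ K)
    (hG : ∀ p ∈ G, Tendsto (fun h => differenceQuotient F h p.1) (nhdsWithin 0 (Ioi 0))
      (nhds p.2)) {s : ℝ} (hs : 0 ≤ s)
    (hdense : Dense ((fun p : X × X => p.1 - s • p.2) '' G)) : BackwardEulerConverges F s := by
  refine exists_continuousLinearMap_tendsto_of_dense (eventually_norm_backwardEuler_le hF hs)
    hdense ?_
  rintro _ ⟨p, hp, rfl⟩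
  exact ⟨p.1, tendsto_backwardEuler_sub_smul hF hG hp hs⟩

theorem norm_pow_le_of_tendsto_backwardEuler (hF : ∀ (n : ℕ) (t : ℝ), 0 ≤ t → ‖F t ^ n‖ ≤ K)
    {s : ℝ} (hs : 0 ≤ s) {L : X →L[ℝ] X}
    (hL : ∀ z, Tendsto (fun h => backwardEuler (differenceQuotient F h) s z)
      (nhdsWithin 0 (Ioi 0)) (nhds (L z))) (n : ℕ) : ‖L ^ n‖ ≤ K := by
  refine ContinuousLinearMap.opNorm_le_bound _ ((norm_nonneg _).trans (hF 0 0 le_rfl)) fun z => ?_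
  refine le_of_tendsto (tendsto_pow_apply_of_norm_le (eventually_norm_backwardEuler_le hF hs) hL n
    (tendsto_const_nhds (x := z))).norm ?_
  filter_upwards [self_mem_nhdsWithin] with h hh
  exact ContinuousLinearMap.le_of_opNorm_le _
    (norm_backwardEuler_pow_le hh (norm_pow_differenceQuotient_le hF hh) hs n) z

theorem BackwardEulerConverges.of_lt_two_mul (hF : ∀ (n : ℕ) (t : ℝ), 0 ≤ t → ‖F t ^ n‖ ≤ K)
    {s r : ℝ} (hs : 0 < s) (hsr : s < 2 * r) (hconv : BackwardEulerConverges F s) :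
    BackwardEulerConverges F r := by
  obtain ⟨L, hL⟩ := hconv
  have hr : 0 < r := by linarith
  set q : ℝ := 1 - s / r with hq
  have hq1 : |q| < 1 := by
    have h1 : s / r < 2 := by rwa [div_lt_iff₀ hr]
    have h2 : 0 < s / r := by positivity
    rw [abs_lt]; constructor <;> linarith
  have hunit := isUnit_one_sub_smul_of_norm_pow_le
    (norm_pow_le_of_tendsto_backwardEuler hF hs.le hL) hq1
  refine exists_continuousLinearMap_tendsto_of_dense
    (eventually_norm_backwardEuler_le hF hr.le) dense_univ fun z _ => ?_
  obtain ⟨w, rfl⟩ : ∃ w, (1 - q • L) w = z :=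
    ⟨Ring.inverse (1 - q • L) z,
      congrArg (fun W : X →L[ℝ] X => W z) (Ring.mul_inverse_cancel _ hunit)⟩
  refine ⟨(s / r) • L w, ?_⟩
  have hzero : Tendsto (fun h => backwardEuler (differenceQuotient F h) r
      (backwardEuler (differenceQuotient F h) s w - L w)) (nhdsWithin 0 (Ioi 0)) (nhds 0) := by
    have hlim : Tendsto (fun h => K * ‖backwardEuler (differenceQuotient F h) s w - L w‖)
        (nhdsWithin 0 (Ioi 0)) (nhds 0) := by
      simpa using ((tendsto_sub_nhds_zero_iff.2 (hL w)).norm).const_mul K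
    exact squeeze_zero_norm' ((eventually_norm_backwardEuler_le hF hr.le).mono fun h hh =>
      (backwardEuler _ r).le_of_opNorm_le hh _) hlim
  have hsum := ((hL w).const_smul (s / r)).add (hzero.const_smul q)
  rw [smul_zero, add_zero] at hsum
  refine hsum.congr' ?_
  filter_upwards [self_mem_nhdsWithin] with h hh
  have hB := norm_pow_differenceQuotient_le hF hh
  set B := differenceQuotient F h
  set J := backwardEuler B s
  have key : (s / r) • J w = backwardEuler B r (w - q • J w) := by
    rw [← backwardEuler_apply_sub_smul hh hB hr.le ((s / r) • J w)]
    congr 1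
    rw [map_smul, smul_smul, mul_div_cancel₀ _ hr.ne', smul_apply_backwardEuler hh hB hs.le, hq,
      sub_smul, one_smul]
    abel
  rw [key, ← (backwardEuler B r).map_smul q, ← map_add]
  congr 1
  simp [smul_sub]

theorem BackwardEulerConverges.of_pos (hF : ∀ (n : ℕ) (t : ℝ), 0 ≤ t → ‖F t ^ n‖ ≤ K)
    {s r : ℝ} (hs : 0 < s) (hr : 0 ≤ r) (hconv : BackwardEulerConverges F s) :
    BackwardEulerConverges F r := by
  rcases hr.eq_or_lt with rfl | hr
  · exact ⟨1, fun z => by simp [backwardEuler]⟩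
  have hpow : ∀ n : ℕ, BackwardEulerConverges F ((2 / 3) ^ n * s) := by
    intro n
    induction n with
    | zero => simpa using hconv
    | succ n ih =>
      refine ih.of_lt_two_mul hF (by positivity) ?_
      have : 0 < (2 / 3 : ℝ) ^ n * s := by positivity
      rw [pow_succ]
      linarith
  obtain ⟨n, hn⟩ := exists_pow_lt_of_lt_one (div_pos hr hs) (by norm_num : (2 / 3 : ℝ) < 1)
  rw [lt_div_iff₀ hs] at hn
  exact (hpow n).of_lt_two_mul hF (by positivity) (by linarith)

theorem denseRange_of_tendsto_backwardEuler (hF : ∀ (n : ℕ) (t : ℝ), 0 ≤ t → ‖F t ^ n‖ ≤ K)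
    (hG : ∀ p ∈ G, Tendsto (fun h => differenceQuotient F h p.1) (nhdsWithin 0 (Ioi 0))
      (nhds p.2)) (hdom : Dense (Prod.fst '' G)) {s : ℝ} (hs : 0 ≤ s) {L : X →L[ℝ] X}
    (hL : ∀ z, Tendsto (fun h => backwardEuler (differenceQuotient F h) s z)
      (nhdsWithin 0 (Ioi 0)) (nhds (L z))) : DenseRange L := by
  refine hdom.mono ?_
  rintro _ ⟨p, hp, rfl⟩
  exact ⟨p.1 - s • p.2,
    tendsto_nhds_unique (hL _) (tendsto_backwardEuler_sub_smul hF hG hp hs)⟩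

theorem norm_pow_sub_backwardEuler_pow_div_le
    (hF : ∀ (n : ℕ) (t : ℝ), 0 ≤ t → ‖F t ^ n‖ ≤ K) {h s : ℝ} (hh : 0 < h) (hs : 0 ≤ s)
    {n : ℕ} (hn : 0 < n) (k : ℕ) (x : X) :
    ‖(F h ^ k) x - (backwardEuler (differenceQuotient F h) s ^ n) x‖ ≤
      K * (n * h * (K * ‖differenceQuotient F h x‖)) +
      n * (K * ((((k / n : ℕ) * h) ^ 2 + s ^ 2) *
        (K * ‖differenceQuotient F h (differenceQuotient F h x)‖) +
        |(k / n : ℕ) * h - s| * ‖differenceQuotient F h x‖)) := by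
  have hB := norm_pow_differenceQuotient_le hF hh
  have hK : 0 ≤ K := (norm_nonneg _).trans (hB 0)
  have h1 := norm_pow_sub_backwardEuler_pow_le hh hB hs (k / n) n x
  have h2 := norm_pow_one_add_smul_apply_sub_le hh.le hB (k % n) x
  rw [one_add_smul_differenceQuotient hh.ne'] at h1 h2
  have h3 : ‖(F h ^ k) x - (F h ^ (k / n * n)) x‖ ≤
      K * (n * h * (K * ‖differenceQuotient F h x‖)) := by
    have e : (F h ^ k) x - (F h ^ (k / n * n)) x =
        (F h ^ (k / n * n)) ((F h ^ (k % n)) x - x) := by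
      rw [map_sub, ← mul_apply_eq_comp, ← pow_add, Nat.div_add_mod']
    rw [e]
    refine (ContinuousLinearMap.le_of_opNorm_le _ (hF _ h hh.le) _).trans ?_
    have : ((k % n : ℕ) : ℝ) ≤ n := by exact_mod_cast (Nat.mod_lt k hn).le
    refine mul_le_mul_of_nonneg_left (h2.trans ?_) hK
    gcongr
  exact (norm_sub_le_norm_sub_add_norm_sub _ _ _).trans (add_le_add h3 h1)

theorem exists_tendsto_stepFilter (hF : ∀ (n : ℕ) (t : ℝ), 0 ≤ t → ‖F t ^ n‖ ≤ K) {s : ℝ}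
    (hs : 0 < s) {L : X →L[ℝ] X} (hdense : DenseRange L)
    (hL : ∀ z, Tendsto (fun h => backwardEuler (differenceQuotient F h) s z)
      (nhdsWithin 0 (Ioi 0)) (nhds (L z))) {t : ℝ} (ht : 0 ≤ t) :
    ∃ S : X →L[ℝ] X, ∀ x, Tendsto (fun p : ℝ × ℕ => (F p.1 ^ p.2) x) (stepFilter t)
      (nhds (S x)) := by
  have := neBot_stepFilter ht
  have hK : 0 ≤ K := (norm_nonneg _).trans (hF 0 0 le_rfl)
  have hFK : ∀ᶠ p : ℝ × ℕ in stepFilter t, ‖F p.1 ^ p.2‖ ≤ K :=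
    eventually_pos_stepFilter.mono fun p hp => hF p.2 p.1 hp.le
  refine exists_continuousLinearMap_tendsto_of_dense hFK (hdense.comp hdense L.continuous) ?_
  rintro _ ⟨z, rfl⟩
  refine exists_tendsto_of_forall_eventually_norm_sub_lt fun ε hε => ?_
  set C₁ := s⁻¹ * ((K + 1) * (K * ‖z‖))
  set C₂ := s⁻¹ * ((K + 1) * (s⁻¹ * ((K + 1) * ‖z‖)))
  set y : ℝ × ℕ → X := fun p => backwardEuler (differenceQuotient F p.1) s
    (backwardEuler (differenceQuotient F p.1) s z) with hy
  have hJK := eventually_norm_backwardEuler_le hF hs.le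
  have hylim : Tendsto y (stepFilter t) (nhds (L (L z))) :=
    (tendsto_apply_of_norm_le hJK hL (hL z)).comp tendsto_fst_stepFilter
  have hC : ∀ᶠ p in stepFilter t, ‖differenceQuotient F p.1 (y p)‖ ≤ C₁ ∧
      ‖differenceQuotient F p.1 (differenceQuotient F p.1 (y p))‖ ≤ C₂ := by
    filter_upwards [eventually_pos_stepFilter] with p hp
    have hB := norm_pow_differenceQuotient_le hF hp
    refine ⟨(norm_apply_backwardEuler_le hp hB hs.le hs _).trans ?_, ?_⟩
    · dsimp only [C₁]
      gcongr
      exact ContinuousLinearMap.le_of_opNorm_le _ (norm_backwardEuler_le hp hB hs.le) z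
    · rw [hy, apply_backwardEuler hp hB hs.le]
      refine (norm_apply_backwardEuler_le hp hB hs.le hs _).trans ?_
      dsimp only [C₂]
      gcongr
      exact norm_apply_backwardEuler_le hp hB hs.le hs z
  obtain ⟨n, hn, hnε⟩ : ∃ n : ℕ, 0 < n ∧
      n * (K * (((t / n) ^ 2 + (t / n) ^ 2) * (K * C₂))) < ε := by
    have hlim : Tendsto (fun n : ℕ => 2 * t ^ 2 * K ^ 2 * C₂ / n) atTop (nhds 0) :=
      tendsto_const_div_atTop_nhds_zero_nat _
    obtain ⟨n, hn, hn0⟩ := ((hlim.eventually (gt_mem_nhds hε)).and (eventually_gt_atTop 0)).exists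
    refine ⟨n, hn0, lt_of_eq_of_lt ?_ hn⟩
    have : (n : ℝ) ≠ 0 := by exact_mod_cast hn0.ne'
    field_simp
    ring
  have htn : 0 ≤ t / n := by positivity
  obtain ⟨M, hM⟩ := BackwardEulerConverges.of_pos hF hs htn ⟨L, hL⟩
  refine ⟨(M ^ n) (L (L z)), ?_⟩
  have hfst : Tendsto (fun p : ℝ × ℕ => p.1) (stepFilter t) (nhds 0) :=
    tendsto_fst_stepFilter.mono_right nhdsWithin_le_nhds
  have hbound : Tendsto (fun p : ℝ × ℕ => K * ‖L (L z) - y p‖ +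
      (K * (n * p.1 * (K * C₁)) +
        n * (K * ((((p.2 / n : ℕ) * p.1) ^ 2 + (t / n) ^ 2) * (K * C₂) +
          |(p.2 / n : ℕ) * p.1 - t / n| * C₁))) +
      ‖(backwardEuler (differenceQuotient F p.1) (t / n) ^ n) (y p) - (M ^ n) (L (L z))‖)
      (stepFilter t) (nhds (K * ‖L (L z) - L (L z)‖ + (K * (n * 0 * (K * C₁)) +
        n * (K * (((t / n) ^ 2 + (t / n) ^ 2) * (K * C₂) + |t / n - t / n| * C₁))) +
      ‖(M ^ n) (L (L z)) - (M ^ n) (L (L z))‖)) := by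
    have hm := tendsto_div_mul_stepFilter (t := t) hn
    have hpow := tendsto_pow_apply_of_norm_le
      (tendsto_fst_stepFilter.eventually (eventually_norm_backwardEuler_le hF htn))
      (fun z => (hM z).comp tendsto_fst_stepFilter) n hylim
    refine ((((hylim.const_sub _).norm).const_mul K).add ((((hfst.const_mul _).mul_const _).const_mul
      K).add ((((((hm.pow 2).add_const _).mul_const _).add
        (((hm.sub_const _).abs).mul_const _)).const_mul K).const_mul _))).add ?_
    exact (hpow.sub_const _).norm
  simp only [sub_self, norm_zero, abs_zero, mul_zero, zero_mul, zero_add, add_zero] at hbound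
  filter_upwards [hC, eventually_pos_stepFilter, hbound.eventually (gt_mem_nhds hnε)]
    with p hCp hp hlt
  refine lt_of_le_of_lt ?_ hlt
  have h1 := norm_pow_sub_backwardEuler_pow_div_le hF hp htn hn p.2 (y p)
  have h2 : ‖(F p.1 ^ p.2) (L (L z) - y p)‖ ≤ K * ‖L (L z) - y p‖ :=
    ContinuousLinearMap.le_of_opNorm_le _ (hF _ _ hp.le) _
  have e : (F p.1 ^ p.2) (L (L z)) - (M ^ n) (L (L z)) = (F p.1 ^ p.2) (L (L z) - y p) +
      ((F p.1 ^ p.2) (y p) - (backwardEuler (differenceQuotient F p.1) (t / n) ^ n) (y p)) +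
      ((backwardEuler (differenceQuotient F p.1) (t / n) ^ n) (y p) - (M ^ n) (L (L z))) := by
    rw [map_sub]; abel
  simp only [Function.comp_apply]
  rw [e]
  refine (norm_add₃_le).trans ?_
  gcongr
  refine h1.trans ?_
  have := hp.le
  gcongr
  · exact hCp.1
  · exact hCp.2
  · exact hCp.1

omit [CompleteSpace X] in
theorem exists_semigroup_of_tendsto_stepFilter (hF0 : F 0 = 1)
    (hF : ∀ (n : ℕ) (t : ℝ), 0 ≤ t → ‖F t ^ n‖ ≤ K)
    (hG : ∀ p ∈ G, Tendsto (fun h => differenceQuotient F h p.1) (nhdsWithin 0 (Ioi 0))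
      (nhds p.2)) (hdom : Dense (Prod.fst '' G))
    (hconv : ∀ t, 0 ≤ t → ∃ S : X →L[ℝ] X, ∀ x,
      Tendsto (fun p : ℝ × ℕ => (F p.1 ^ p.2) x) (stepFilter t) (nhds (S x))) :
    ∃ S : ℝ → X →L[ℝ] X, S 0 = 1 ∧
      (∀ s t : ℝ, 0 ≤ s → 0 ≤ t → S (s + t) = S s ∘L S t) ∧
      (∀ x : X, ContinuousOn (fun t => S t x) (Ici (0 : ℝ))) ∧
      (∀ p ∈ closure G, HasDerivWithinAt (fun t => S t p.1) p.2 (Ici (0 : ℝ)) 0) ∧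
      (∀ x : X, ∀ t : ℝ, 0 ≤ t → Tendsto (fun q : ℕ × ℝ => (F (q.2 / q.1) ^ q.1) x)
        (atTop ×ˢ nhdsWithin t (Ici 0)) (nhds (S t x))) := by
  have hK : 0 ≤ K := (norm_nonneg _).trans (hF 0 0 le_rfl)
  have hconv' : ∀ t : ℝ, ∃ S : X →L[ℝ] X, 0 ≤ t → ∀ x,
      Tendsto (fun p : ℝ × ℕ => (F p.1 ^ p.2) x) (stepFilter t) (nhds (S x)) := fun t => by
    by_cases ht : 0 ≤ t
    · exact (hconv t ht).imp fun S hS _ => hS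
    · exact ⟨0, fun h => absurd h ht⟩
  choose S hS using hconv'
  have hS0 : S 0 = 1 := by
    ext x
    have h1 : Tendsto (fun h : ℝ => (h, 0)) (nhdsWithin 0 (Ioi 0)) (stepFilter 0) :=
      tendsto_stepFilter_iff.2 ⟨tendsto_id, by simp⟩
    exact tendsto_nhds_unique ((hS 0 le_rfl x).comp h1) (by simp [Function.comp_def])
  refine ⟨S, hS0, fun s t hs ht => ?_, fun x t ht => ?_, fun p hp => ?_, fun x t ht => ?_⟩
  · ext x
    have hst : Tendsto (fun h : ℝ => (h, ⌊s / h⌋₊ + ⌊t / h⌋₊)) (nhdsWithin 0 (Ioi 0))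
        (stepFilter (s + t)) := by
      refine tendsto_stepFilter_iff.2 ⟨tendsto_id, ?_⟩
      simpa [add_mul] using (tendsto_floor_mul_nhdsGT hs).add (tendsto_floor_mul_nhdsGT ht)
    refine tendsto_nhds_unique ((hS (s + t) (add_nonneg hs ht) x).comp hst) ?_
    have hbd : ∀ᶠ h : ℝ in nhdsWithin 0 (Ioi 0), ‖F h ^ ⌊s / h⌋₊‖ ≤ K := by
      filter_upwards [self_mem_nhdsWithin] with h hh
      exact hF _ h (le_of_lt hh)
    have hprod := tendsto_apply_of_norm_le hbd
      (fun z => (hS s hs z).comp (tendsto_floor_stepFilter hs))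
      ((hS t ht x).comp (tendsto_floor_stepFilter ht))
    simpa only [Function.comp_def, pow_add, mul_apply_eq_comp] using! hprod
  · rw [ContinuousWithinAt, Metric.tendsto_nhds]
    intro ε hε
    have hev := (Metric.tendsto_nhds.1 (hS t ht x) _ (half_pos hε)).eventually_stepFilter
    filter_upwards [nhdsWithin_le_nhds hev, self_mem_nhdsWithin] with t' ht' ht0
    have := neBot_stepFilter ht0
    refine lt_of_le_of_lt (le_of_tendsto ((hS t' ht0 x).dist tendsto_const_nhds)
      (ht'.mono fun p hp => le_of_lt hp)) (half_lt_self hε)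
  · have hGbound : ∀ t, 0 ≤ t → ∀ g ∈ G, ∀ p ∈ closure G,
        ‖S t p.1 - p.1 - t • p.2‖ ≤ t * ((K + 1) * ‖p.2 - g.1‖ + K * t * ‖g.2‖) := by
      intro t ht g hg p hp
      have hclosed : IsClosed {p : X × X |
          ‖S t p.1 - p.1 - t • p.2‖ ≤ t * ((K + 1) * ‖p.2 - g.1‖ + K * t * ‖g.2‖)} :=
        isClosed_le (by fun_prop) (by fun_prop)
      refine closure_minimal (fun p hp => ?_) hclosed hp
      have := neBot_stepFilter ht
      have hGp := (hG p hp).comp (tendsto_fst_stepFilter (t := t))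
      have hGg := (hG g hg).comp (tendsto_fst_stepFilter (t := t))
      have hm := tendsto_mul_stepFilter (t := t)
      refine le_of_tendsto_of_tendsto (((hS t ht p.1).sub_const p.1).sub (hm.smul hGp)).norm
        (hm.mul ((((hGp.sub_const g.1).norm).const_mul (K + 1)).add
          ((hm.const_mul K).mul hGg.norm))) ?_
      filter_upwards [eventually_pos_stepFilter] with q hq
      have := norm_pow_one_add_smul_apply_sub_sub_le hq.le
        (norm_pow_differenceQuotient_le hF hq) q.2 p.1 g.1
      rwa [one_add_smul_differenceQuotient hq.ne'] at this
    rw [hasDerivWithinAt_iff_isLittleO, Asymptotics.isLittleO_iff]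
    intro ε hε
    obtain ⟨_, hg, ⟨g, hgG, rfl⟩⟩ :=
      Metric.dense_iff.1 hdom p.2 (ε / 2 / (K + 1)) (by positivity)
    rw [Metric.mem_ball, dist_comm, dist_eq_norm, lt_div_iff₀ (by positivity)] at hg
    have hlim : Tendsto (fun t : ℝ => K * t * ‖g.2‖) (nhdsWithin 0 (Ici 0)) (nhds 0) := by
      have : Tendsto (fun t : ℝ => K * t * ‖g.2‖) (nhds 0) (nhds (K * 0 * ‖g.2‖)) :=
        (tendsto_id.const_mul K).mul_const _
      simpa using tendsto_nhdsWithin_of_tendsto_nhds this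
    filter_upwards [hlim.eventually (gt_mem_nhds (half_pos hε)), self_mem_nhdsWithin] with t h1 ht
    have h2 := hGbound t ht g hgG p hp
    have ht' : (0 : ℝ) ≤ t := ht
    rw [hS0, sub_zero, Real.norm_eq_abs, abs_of_nonneg ht']
    refine h2.trans ?_
    rw [mul_comm]
    gcongr
    linarith
  · have hle : nhdsWithin t (Ici 0) ≤ nhdsWithin t {0} ⊔ nhdsWithin t (Ioi (0 : ℝ)) := by
      rw [← nhdsWithin_union, singleton_union, Ioi_insert]
    refine Tendsto.mono_left ?_ (prod_mono_right atTop hle)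
    rw [prod_sup, tendsto_sup]
    constructor
    · rcases ht.eq_or_lt with rfl | ht
      · rw [hS0]
        refine tendsto_const_nhds.congr' ?_
        filter_upwards [tendsto_snd.eventually self_mem_nhdsWithin] with q hq
        have hq' : q.2 = 0 := hq
        simp [hq', hF0]
      · have : nhdsWithin t {0} = (⊥ : Filter ℝ) := by
          rw [← notMem_closure_iff_nhdsWithin_eq_bot]
          simpa using ht.ne'
        simp [this]
    · refine (hS t ht x).comp (f := fun q : ℕ × ℝ => (q.2 / q.1, q.1))
        (tendsto_stepFilter_iff.2 ⟨tendsto_nhdsWithin_iff.2 ⟨?_, ?_⟩, ?_⟩)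
      · exact (tendsto_nhdsWithin_of_tendsto_nhds tendsto_id |>.comp tendsto_snd).div_atTop
          (tendsto_natCast_atTop_atTop.comp tendsto_fst)
      · filter_upwards [tendsto_snd.eventually self_mem_nhdsWithin,
          tendsto_fst.eventually (eventually_gt_atTop 0)] with q hq hq'
        exact div_pos hq (by exact_mod_cast hq')
      · refine (tendsto_nhdsWithin_of_tendsto_nhds tendsto_id |>.comp tendsto_snd).congr' ?_
        filter_upwards [tendsto_fst.eventually (eventually_gt_atTop 0)] with q hq'
        have : (q.1 : ℝ) ≠ 0 := by exact_mod_cast hq'.ne'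
        simp only [Function.comp_apply, id]
        field_simp

theorem exists_semigroup_of_dense_sub_smul (hF0 : F 0 = 1)
    (hF : ∀ (n : ℕ) (t : ℝ), 0 ≤ t → ‖F t ^ n‖ ≤ K)
    (hG : ∀ p ∈ G, Tendsto (fun h => differenceQuotient F h p.1) (nhdsWithin 0 (Ioi 0))
      (nhds p.2)) (hdom : Dense (Prod.fst '' G)) {s : ℝ} (hs : 0 < s)
    (hrange : Dense ((fun p : X × X => p.1 - s • p.2) '' G)) :
    ∃ S : ℝ → X →L[ℝ] X, S 0 = 1 ∧
      (∀ s t : ℝ, 0 ≤ s → 0 ≤ t → S (s + t) = S s ∘L S t) ∧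
      (∀ x : X, ContinuousOn (fun t => S t x) (Ici (0 : ℝ))) ∧
      (∀ p ∈ closure G, HasDerivWithinAt (fun t => S t p.1) p.2 (Ici (0 : ℝ)) 0) ∧
      (∀ x : X, ∀ t : ℝ, 0 ≤ t → Tendsto (fun q : ℕ × ℝ => (F (q.2 / q.1) ^ q.1) x)
        (atTop ×ˢ nhdsWithin t (Ici 0)) (nhds (S t x))) := by
  obtain ⟨L, hL⟩ := backwardEulerConverges_of_dense hF hG hs.le hrange
  exact exists_semigroup_of_tendsto_stepFilter hF0 hF hG hdom fun t ht =>
    exists_tendsto_stepFilter hF hs (denseRange_of_tendsto_backwardEuler hF hG hdom hs.le hL) hL ht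

theorem exists_semigroup_of_norm_pow_le_exp {a : ℝ} (hF0 : F 0 = 1)
    (hF : ∀ (n : ℕ) (t : ℝ), 0 ≤ t → ‖F t ^ n‖ ≤ K * Real.exp (a * n * t))
    (hG : ∀ p ∈ G, Tendsto (fun h => differenceQuotient F h p.1) (nhdsWithin 0 (Ioi 0))
      (nhds p.2)) (hdom : Dense (Prod.fst '' G)) {lam : ℝ} (hlam : a < lam)
    (hrange : Dense ((fun p : X × X => lam • p.1 - p.2) '' G)) :
    ∃ S : ℝ → X →L[ℝ] X, S 0 = 1 ∧
      (∀ s t : ℝ, 0 ≤ s → 0 ≤ t → S (s + t) = S s ∘L S t) ∧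
      (∀ x : X, ContinuousOn (fun t => S t x) (Ici (0 : ℝ))) ∧
      (∀ p ∈ closure G, HasDerivWithinAt (fun t => S t p.1) p.2 (Ici (0 : ℝ)) 0) ∧
      (∀ x : X, ∀ t : ℝ, 0 ≤ t → Tendsto (fun q : ℕ × ℝ => (F (q.2 / q.1) ^ q.1) x)
        (atTop ×ˢ nhdsWithin t (Ici 0)) (nhds (S t x))) := by
  set E : ℝ → X →L[ℝ] X := fun t => Real.exp (-a * t) • F t with hE
  set φ : X × X → X × X := fun p => (p.1, p.2 - a • p.1) with hφ
  have hEpow : ∀ (n : ℕ) (t : ℝ), E t ^ n = Real.exp (-(a * n * t)) • F t ^ n := by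
    intro n t
    rw [hE, smul_pow, ← Real.exp_nat_mul]
    congr 2
    ring
  have hs : 0 < (lam - a)⁻¹ := inv_pos.2 (sub_pos.2 hlam)
  have hEexp : HasDerivWithinAt (fun t : ℝ => Real.exp (-a * t)) (-a) (Ioi 0) 0 := by
    simpa using (((hasDerivAt_id (0 : ℝ)).const_mul (-a)).exp).hasDerivWithinAt
  have hEnorm : ∀ (n : ℕ) (t : ℝ), 0 ≤ t → ‖E t ^ n‖ ≤ K := by
    intro n t ht
    rw [hEpow, norm_smul, Real.norm_eq_abs, Real.abs_exp]
    calc Real.exp (-(a * n * t)) * ‖F t ^ n‖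
        ≤ Real.exp (-(a * n * t)) * (K * Real.exp (a * n * t)) := by gcongr; exact hF n t ht
      _ = K := by rw [mul_left_comm, ← Real.exp_add, neg_add_cancel, Real.exp_zero, mul_one]
  have hEG : ∀ p ∈ φ '' G, Tendsto (fun h => differenceQuotient E h p.1)
      (nhdsWithin 0 (Ioi 0)) (nhds p.2) := by
    rintro _ ⟨p, hp, rfl⟩
    have h1 : Tendsto (fun h : ℝ => Real.exp (-a * h)) (nhdsWithin 0 (Ioi 0)) (nhds 1) := by
      simpa using hEexp.continuousWithinAt.tendsto
    have h2 := (hasDerivWithinAt_iff_tendsto_slope' (by simp)).1 hEexp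
    have h3 := (h1.smul (hG p hp)).add (h2.smul_const p.1)
    rw [one_smul, neg_smul, ← sub_eq_add_neg] at h3
    refine h3.congr fun h => ?_
    simp only [slope, differenceQuotient, hE, hφ, vsub_eq_sub, sub_zero, mul_zero, Real.exp_zero,
      smul_apply, sub_apply, one_apply_eq_self, smul_eq_mul]
    module
  have hEdom : Dense (Prod.fst '' (φ '' G)) := by
    rwa [← image_comp]
  have hErange : Dense ((fun p : X × X => p.1 - (lam - a)⁻¹ • p.2) '' (φ '' G)) := by
    rw [← image_comp]
    have hsurj : Function.Surjective fun x : X => (lam - a)⁻¹ • x :=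
      fun x => ⟨(lam - a) • x, inv_smul_smul₀ (sub_pos.2 hlam).ne' x⟩
    have := hsurj.denseRange.dense_image (continuous_const_smul _) hrange
    rw [← image_comp] at this
    refine (congrArg Dense (image_congr fun p _ => ?_)).mp this
    simp only [Function.comp_apply, hφ]
    calc (lam - a)⁻¹ • (lam • p.1 - p.2)
        = ((lam - a)⁻¹ * (lam - a)) • p.1 - (lam - a)⁻¹ • (p.2 - a • p.1) := by module
      _ = _ := by rw [inv_mul_cancel₀ (sub_pos.2 hlam).ne', one_smul]
  obtain ⟨S, hS0, hSadd, hScont, hSderiv, hSlim⟩ := exists_semigroup_of_dense_sub_smul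
    (by simp [hE, hF0]) hEnorm hEG hEdom hs hErange
  refine ⟨fun t => Real.exp (a * t) • S t, by simp [hS0], fun s t hs ht => ?_, fun x => ?_,
    fun p hp => ?_, fun x t ht => ?_⟩
  · ext x
    simp [hSadd s t hs ht, mul_add, Real.exp_add, smul_smul, mul_comm]
  · exact (Continuous.continuousOn (by fun_prop)).smul (hScont x)
  · have hφc : Continuous φ := by fun_prop
    have h1 := hSderiv (φ p) (image_closure_subset_closure_image hφc (mem_image_of_mem φ hp))
    have h2 : HasDerivWithinAt (fun t : ℝ => Real.exp (a * t)) a (Ici 0) 0 := by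
      simpa using (((hasDerivAt_id (0 : ℝ)).const_mul a).exp).hasDerivWithinAt
    simpa [hφ, hS0] using! h2.smul h1
  · have h1 : Tendsto (fun q : ℕ × ℝ => Real.exp (a * q.2)) (atTop ×ˢ nhdsWithin t (Ici 0))
        (nhds (Real.exp (a * t))) :=
      (tendsto_nhdsWithin_of_tendsto_nhds
        (Continuous.tendsto (f := fun t => Real.exp (a * t)) (by fun_prop) t)).comp tendsto_snd
    refine (h1.smul (hSlim x t ht)).congr' ?_
    filter_upwards [tendsto_fst.eventually (eventually_gt_atTop 0)] with q hq
    have hq' : (q.1 : ℝ) ≠ 0 := by exact_mod_cast hq.ne'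
    have e : a * q.1 * (q.2 / q.1) = a * q.2 := by field_simp
    rw [hEpow, e, smul_apply, smul_smul, ← Real.exp_add, add_neg_cancel, Real.exp_zero, one_smul]

end Chernoff

theorem LinearPMap.isClosable_of_forall_mem_closure_graph {X : Type*} [NormedAddCommGroup X]
    [NormedSpace ℝ X] {A : X →ₗ.[ℝ] X}
    (hA : ∀ w : X, ((0 : X), w) ∈ _root_.closure (A.graph : Set (X × X)) → w = 0) : A.IsClosable := by
  refine ⟨A.graph.topologicalClosure.toLinearPMap,
    (Submodule.toLinearPMap_graph_eq _ fun p hp hp1 => hA p.2 ?_).symm⟩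
  rw [← hp1]
  exact hp

/-- Chernoff product formula: if `F(0) = I`, `‖F(t)^n‖ ≤ K e^{ant}`, the derivative `F'(0)`
exists on a dense subspace (encoded as the unbounded operator `A`), and `(λ - F'(0))D` is
dense for some `λ > a`, then `F'(0)` is closable, its closure generates a C₀-semigroup `S`,
and `F(t/n)^n → S(t)` strongly, uniformly on compact time intervals. -/
theorem chernoff_product_formula
    {X : Type*} [NormedAddCommGroup X] [NormedSpace ℝ X] [CompleteSpace X]
    (F : ℝ → X →L[ℝ] X) (K a : ℝ) (hK : 1 ≤ K)
    (hF0 : F 0 = 1)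
    (hFnorm : ∀ (n : ℕ) (t : ℝ), 0 ≤ t → ‖(F t) ^ n‖ ≤ K * Real.exp (a * n * t))
    (A : X →ₗ.[ℝ] X) (hdense : Dense (A.domain : Set X))
    (hderiv : ∀ y : A.domain,
      Tendsto (fun t : ℝ => t⁻¹ • (F t (y : X) - (y : X))) (nhdsWithin 0 (Ioi 0)) (nhds (A y)))
    (lam : ℝ) (hlam : a < lam)
    (hrange : Dense (Set.range (fun y : A.domain => lam • (y : X) - A y))) :
    A.IsClosable ∧
    ∃ S : ℝ → X →L[ℝ] X,
      S 0 = 1 ∧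
      (∀ s t : ℝ, 0 ≤ s → 0 ≤ t → S (s + t) = S s ∘L S t) ∧
      (∀ x : X, ContinuousOn (fun t => S t x) (Ici (0 : ℝ))) ∧
      (∀ y : A.closure.domain,
        HasDerivWithinAt (fun t => S t (y : X)) (A.closure y) (Ici (0 : ℝ)) 0) ∧
      (∀ x : X, ∀ T : ℝ, 0 < T →
        TendstoUniformlyOn (fun (n : ℕ) (t : ℝ) => ((F (t / n)) ^ n) x)
          (fun t => S t x) atTop (Icc 0 T)) := by
  have hG : ∀ p ∈ (A.graph : Set (X × X)), Tendsto (fun h => differenceQuotient F h p.1)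
      (nhdsWithin 0 (Ioi 0)) (nhds p.2) := by
    intro p hp
    obtain ⟨y, hy1, hy2⟩ := (LinearPMap.mem_graph_iff A).1 hp
    rw [← hy1, ← hy2]
    exact hderiv y
  have hmem : ∀ y : A.domain, ((y : X), A y) ∈ (A.graph : Set (X × X)) := A.mem_graph
  obtain ⟨S, hS0, hSadd, hScont, hSderiv, hSlim⟩ := exists_semigroup_of_norm_pow_le_exp hF0 hFnorm
    hG (hdense.mono fun y hy => ⟨_, hmem ⟨y, hy⟩, rfl⟩) hlam
    (hrange.mono (range_subset_iff.2 fun y => ⟨_, hmem y, rfl⟩))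
  have hclos : A.IsClosable := LinearPMap.isClosable_of_forall_mem_closure_graph fun w hw => by
    have h0 : HasDerivWithinAt (fun _ : ℝ => (0 : X)) w (Ici 0) 0 := by
      simpa using hSderiv _ hw
    exact (uniqueDiffWithinAt_Ici (0 : ℝ)).eq_deriv _ h0 (hasDerivWithinAt_const _ _ _)
  refine ⟨hclos, S, hS0, hSadd, hScont, fun y => ?_, fun x T hT => ?_⟩
  · refine hSderiv (y, A.closure y) ?_
    rw [← Submodule.topologicalClosure_coe, hclos.graph_closure_eq_closure_graph]
    exact A.closure.mem_graph y
  · rw [← tendstoLocallyUniformlyOn_iff_tendstoUniformlyOn_of_compact isCompact_Icc,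
      tendstoLocallyUniformlyOn_iff_forall_tendsto]
    intro t ht
    have hsub : nhdsWithin t (Icc 0 T) ≤ nhdsWithin t (Ici 0) :=
      nhdsWithin_mono t Icc_subset_Ici_self
    have h1 : Tendsto (fun q : ℕ × ℝ => S q.2 x) (atTop ×ˢ nhdsWithin t (Icc 0 T))
        (nhds (S t x)) :=
      ((hScont x t ht.1).mono_left hsub).comp tendsto_snd
    exact (h1.prodMk_nhds ((hSlim x t ht.1).mono_left (prod_mono_right atTop hsub))).mono_right
      (nhds_le_uniformity _)
end

section
/- Let X be a p-smooth Banach space, 1 < p ≤ 2, and let (μ_m)_{m≤n} with μ_m = ∑_{k=1}^m d_k be a martingale in X adapted to a filtration (F_m), with martingale differences d_k. Then for every r ≥ 1 there exists C = C(X, r, p) > 0 such that E‖μ_n‖^r ≤ C · E( ∑_{k=1}^n ‖d_k‖^p )^{r/p}. -/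
open MeasureTheory Finset

theorem Real.rpow_add_sub_rpow_antitone {α a b h : ℝ} (h0 : 0 ≤ α) (h1 : α ≤ 1) (ha : 0 ≤ a)
    (hab : a ≤ b) (hh : 0 ≤ h) : (b + h) ^ α - b ^ α ≤ (a + h) ^ α - a ^ α := by
  have hc := Real.concaveOn_rpow h0 h1
  rcases (add_nonneg (sub_nonneg.2 hab) hh).eq_or_lt with e | e
  · have : b = a := by linarith
    rw [this]
  · have hl : (b - a) / (b - a + h) + h / (b - a + h) = 1 := by
      rw [← add_div, div_self e.ne']
    have hw1 : 0 ≤ (b - a) / (b - a + h) := div_nonneg (by linarith) e.le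
    have hw2 : 0 ≤ h / (b - a + h) := div_nonneg hh e.le
    have A := hc.2 (x := a) (y := b + h) ha (add_nonneg (ha.trans hab) hh) hw1 hw2 hl
    have B := hc.2 (x := a) (y := b + h) ha (add_nonneg (ha.trans hab) hh) hw2 hw1
      (by rw [add_comm]; exact hl)
    simp only [smul_eq_mul] at A B
    have eA : (b - a) / (b - a + h) * a + h / (b - a + h) * (b + h) = a + h := by
      field_simp; ring
    have eB : h / (b - a + h) * a + (b - a) / (b - a + h) * (b + h) = b := by
      field_simp; ring
    rw [eA] at A
    rw [eB] at B
    have : ((b - a) / (b - a + h) + h / (b - a + h)) * (a ^ α + (b + h) ^ α)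
      = a ^ α + (b + h) ^ α := by rw [hl, one_mul]
    linarith

theorem Real.rpow_add_mul_sub_rpow_le {α a c δ : ℝ} (h0 : 0 ≤ α) (h1 : α ≤ 1) (ha : 0 ≤ a)
    (hc : 1 ≤ c) (hδ : 0 ≤ δ) : (a + c * δ) ^ α - a ^ α ≤ c * ((a + δ) ^ α - a ^ α) := by
  have hc0 : 0 < c := by linarith
  have A := (Real.concaveOn_rpow h0 h1).2 (x := a) (y := a + c * δ) ha
    (show 0 ≤ a + c * δ by positivity)
    (sub_nonneg.2 (inv_le_one_of_one_le₀ hc)) (inv_nonneg.2 hc0.le) (by ring)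
  simp only [smul_eq_mul] at A
  have e : (1 - c⁻¹) * a + c⁻¹ * (a + c * δ) = a + δ := by field_simp; ring
  rw [e] at A
  have := mul_le_mul_of_nonneg_left A hc0.le
  have e2 : c * ((1 - c⁻¹) * a ^ α + c⁻¹ * (a + c * δ) ^ α)
    = (c - 1) * a ^ α + (a + c * δ) ^ α := by field_simp
  linarith

theorem Real.rpow_drift_le_of_le_one {α C s δ m u v : ℝ} (h0 : 0 ≤ α) (h1 : α ≤ 1) (hC : 2 ≤ C)
    (hs : 0 ≤ s) (hδ : 0 ≤ δ) (hm : 0 ≤ m) (hu : 0 ≤ u) (hv : 0 ≤ v)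
    (h : u + v ≤ 2 * m + C * δ) :
    (s + δ + u) ^ α + (s + v) ^ α ≤ 2 * (s + m) ^ α + (C + 1) * ((s + δ) ^ α - s ^ α) := by
  have A := Real.rpow_add_sub_rpow_antitone h0 h1 hs (le_add_of_nonneg_right hu) hδ
  have B := (Real.concaveOn_rpow h0 h1).2 (x := s + u) (y := s + v) (add_nonneg hs hu)
    (add_nonneg hs hv) (by norm_num : (0 : ℝ) ≤ 1 / 2) (by norm_num : (0 : ℝ) ≤ 1 / 2)
    (by norm_num)
  simp only [smul_eq_mul] at B
  have D : (1 / 2 * (s + u) + 1 / 2 * (s + v)) ^ α ≤ (s + m + C / 2 * δ) ^ α :=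
    Real.rpow_le_rpow (by positivity) (by linarith) h0
  have E := Real.rpow_add_sub_rpow_antitone h0 h1 hs (le_add_of_nonneg_right hm)
    (show 0 ≤ C / 2 * δ by positivity)
  have F := Real.rpow_add_mul_sub_rpow_le h0 h1 hs (by linarith : 1 ≤ C / 2) hδ
  have e : s + δ + u = s + u + δ := by ring
  rw [e]
  linarith

theorem Real.rpow_add_drift_le {α a b : ℝ} (h1 : 1 ≤ α) (ha : 0 ≤ a) (hb : 0 ≤ b) :
    a ^ α + (b * a ^ (α - 1) + b ^ α) / 2 ≤ (a + b) ^ α := by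
  rcases ha.eq_or_lt with rfl | ha'
  · rcases hb.eq_or_lt with rfl | hb'
    · simp [Real.zero_rpow (show α ≠ 0 by linarith)]
    · have : b * 0 ^ (α - 1) ≤ b ^ α := by
        have : b ^ α = b * b ^ (α - 1) := by
          rw [Real.rpow_sub_one hb'.ne']; field_simp
        rw [this]
        exact mul_le_mul_of_nonneg_left (Real.rpow_le_rpow le_rfl hb (by linarith)) hb
      rw [Real.zero_rpow (show α ≠ 0 by linarith), zero_add, zero_add]
      linarith
  · have key : (a + b) ^ α = (a + b) * (a + b) ^ (α - 1) := by
      rw [Real.rpow_sub_one (by positivity)]; field_simp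
    have ka : a ^ α = a * a ^ (α - 1) := by
      rw [Real.rpow_sub_one (by positivity)]; field_simp
    have kb : b ^ α = b * b ^ (α - 1) := by
      rcases hb.eq_or_lt with rfl | hb'
      · simp [Real.zero_rpow (show α ≠ 0 by linarith)]
      · rw [Real.rpow_sub_one (by positivity)]; field_simp
    have A : a ^ (α - 1) ≤ (a + b) ^ (α - 1) :=
      Real.rpow_le_rpow ha (by linarith) (by linarith)
    have B : b ^ (α - 1) ≤ (a + b) ^ (α - 1) :=
      Real.rpow_le_rpow hb (by linarith) (by linarith)
    rw [key, ka, kb]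
    nlinarith [mul_le_mul_of_nonneg_left A ha, mul_le_mul_of_nonneg_left A hb,
      mul_le_mul_of_nonneg_left B hb]

theorem Real.exists_abs_rpow_sub_one_le (q : ℝ) :
    ∃ K, 0 ≤ K ∧ ∀ u ∈ Set.Icc (1 / 2 : ℝ) (3 / 2), |u ^ q - 1| ≤ K * |u - 1| := by
  have hc : ContDiffOn ℝ 1 (fun u : ℝ => u ^ q) (Set.Icc (1 / 2 : ℝ) (3 / 2)) := fun u hu =>
    (Real.contDiffAt_rpow_const_of_ne (by linarith [hu.1])).contDiffWithinAt
  obtain ⟨K, hK⟩ := hc.exists_lipschitzOnWith one_ne_zero (convex_Icc _ _) isCompact_Icc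
  refine ⟨K, K.2, fun u hu => ?_⟩
  simpa [Real.dist_eq] using hK.dist_le_mul u hu 1 (by norm_num)

theorem Real.rpow_le_add_sub_mul {α z : ℝ} (hα : 1 ≤ α) (hz : 0 < z) :
    z ^ α ≤ 1 + α * (z - 1) + α * (z ^ (α - 1) - 1) * (z - 1) := by
  have := one_add_mul_self_le_rpow_one_add (s := z⁻¹ - 1) (by linarith [inv_pos.2 hz]) hα
  rw [add_sub_cancel, Real.inv_rpow hz.le] at this
  have h2 := mul_le_mul_of_nonneg_right this (Real.rpow_nonneg hz.le α)
  rw [inv_mul_cancel₀ (Real.rpow_pos_of_pos hz α).ne'] at h2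
  have e : z ^ (α - 1) = z⁻¹ * z ^ α := by rw [Real.rpow_sub_one hz.ne']; field_simp
  have e2 : z * z ^ (α - 1) = z ^ α := by rw [e]; field_simp
  rw [e] at e2 ⊢
  nlinarith

theorem Real.exists_rpow_add_rpow_le {p r C : ℝ} (hp1 : 1 < p) (hp2 : p ≤ 2) (hr : p ≤ r)
    (hC : 0 ≤ C) : ∃ K, 2 ≤ K ∧ ∀ t u v : ℝ, 0 ≤ u → 0 ≤ v → |u - 1| ≤ t → |v - 1| ≤ t →
      u ^ p + v ^ p ≤ 2 + C * t ^ p → u ^ r + v ^ r ≤ 2 + K * (t ^ p + t ^ r) := by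
  have hp0 : 0 < p := by linarith
  have hα : 1 ≤ r / p := (one_le_div hp0).2 hr
  obtain ⟨K₁, h₁, H₁⟩ := Real.exists_abs_rpow_sub_one_le p
  obtain ⟨K₂, h₂, H₂⟩ := Real.exists_abs_rpow_sub_one_le (r - p)
  have h3 : (1 : ℝ) ≤ 3 ^ r := Real.one_le_rpow (by norm_num) (by linarith)
  have hA : 0 ≤ r / p * C + 2 * (r / p * (K₂ * K₁)) := by positivity
  refine ⟨r / p * C + 2 * (r / p * (K₂ * K₁)) + 2 * 3 ^ r, by linarith,
    fun t u v hu hv hut hvt h => ?_⟩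
  have ht : 0 ≤ t := (abs_nonneg _).trans hut
  have htp := Real.rpow_nonneg ht p
  have htr := Real.rpow_nonneg ht r
  rcases le_or_gt t (1 / 2) with hts | hts
  · have key : ∀ w : ℝ, |w - 1| ≤ t →
        w ^ r ≤ 1 + r / p * (w ^ p - 1) + r / p * (K₂ * K₁) * t ^ p := by
      intro w hw
      have hw' := abs_le.1 hw
      have hmem : w ∈ Set.Icc (1 / 2 : ℝ) (3 / 2) := ⟨by linarith [hw'.1], by linarith [hw'.2]⟩
      have hw0 : 0 < w := by linarith [hmem.1]
      have T := Real.rpow_le_add_sub_mul hα (Real.rpow_pos_of_pos hw0 p)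
      rw [← Real.rpow_mul hw0.le, ← Real.rpow_mul hw0.le, mul_div_cancel₀ _ hp0.ne',
        show p * (r / p - 1) = r - p by field_simp] at T
      have B₁ := (H₁ w hmem).trans (mul_le_mul_of_nonneg_left hw h₁)
      have B₂ := (H₂ w hmem).trans (mul_le_mul_of_nonneg_left hw h₂)
      have P : (w ^ (r - p) - 1) * (w ^ p - 1) ≤ (K₂ * t) * (K₁ * t) := by
        refine (le_abs_self _).trans ?_
        rw [abs_mul]
        exact mul_le_mul B₂ B₁ (abs_nonneg _) (by positivity)
      have Q : t ^ 2 ≤ t ^ p := by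
        rw [← Real.rpow_natCast]
        exact Real.rpow_le_rpow_of_exponent_ge_of_imp ht (by linarith) (by simpa using hp2)
          (fun _ h => absurd h (by norm_num))
      have R : (K₂ * t) * (K₁ * t) ≤ K₂ * K₁ * t ^ p := by
        have := mul_le_mul_of_nonneg_left Q (mul_nonneg h₂ h₁)
        linarith
      have := mul_le_mul_of_nonneg_left (P.trans R) (by linarith : 0 ≤ r / p)
      linarith
    have U := key u hut
    have V := key v hvt
    have W := mul_le_mul_of_nonneg_left h (by linarith : 0 ≤ r / p)
    have X : 0 ≤ (r / p * C + 2 * (r / p * (K₂ * K₁))) * t ^ r := by positivity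
    have Y : 0 ≤ 2 * 3 ^ r * (t ^ p + t ^ r) := by positivity
    linarith
  · have key : ∀ w : ℝ, 0 ≤ w → |w - 1| ≤ t → w ^ r ≤ 3 ^ r * t ^ r := by
      intro w hw0 hw
      rw [← Real.mul_rpow (by norm_num) ht]
      exact Real.rpow_le_rpow hw0 (by linarith [(abs_le.1 hw).2]) (by linarith)
    have U := key u hu hut
    have V := key v hv hvt
    have X : 0 ≤ (r / p * C + 2 * (r / p * (K₂ * K₁))) * (t ^ p + t ^ r) := by positivity
    have Y : 0 ≤ 2 * 3 ^ r * t ^ p := by positivity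
    linarith

section Smooth

variable {X : Type*} [NormedAddCommGroup X]

theorem exists_norm_add_rpow_add_norm_sub_rpow_le {p r C : ℝ} (hp1 : 1 < p) (hp2 : p ≤ 2)
    (hr : p ≤ r) (hC : 0 ≤ C)
    (hX : ∀ x y : X, ‖x + y‖ ^ p + ‖x - y‖ ^ p ≤ 2 * ‖x‖ ^ p + C * ‖y‖ ^ p) :
    ∃ K, 2 ≤ K ∧ ∀ x y : X, ‖x + y‖ ^ r + ‖x - y‖ ^ r ≤
      2 * ‖x‖ ^ r + K * (‖x‖ ^ (r - p) * ‖y‖ ^ p + ‖y‖ ^ r) := by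
  obtain ⟨K, hK, H⟩ := Real.exists_rpow_add_rpow_le hp1 hp2 hr hC
  refine ⟨K, hK, fun x y => ?_⟩
  have hr0 : 0 < r := by linarith
  rcases eq_or_ne x 0 with rfl | hx
  · simp only [zero_add, zero_sub, norm_neg, norm_zero, Real.zero_rpow hr0.ne']
    have A : 0 ≤ K * ((0 : ℝ) ^ (r - p) * ‖y‖ ^ p) := by positivity
    have B : 0 ≤ (K - 2) * ‖y‖ ^ r := mul_nonneg (by linarith) (by positivity)
    linarith
  · have hn : 0 < ‖x‖ := norm_pos_iff.2 hx
    have hpn : 0 < ‖x‖ ^ p := Real.rpow_pos_of_pos hn p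
    have hrn : 0 < ‖x‖ ^ r := Real.rpow_pos_of_pos hn r
    have bound : ∀ z : X, ‖x - z‖ = ‖y‖ → |‖z‖ / ‖x‖ - 1| ≤ ‖y‖ / ‖x‖ := by
      intro z hz
      rw [div_sub_one hn.ne', abs_div, abs_of_pos hn, ← hz]
      gcongr
      rw [norm_sub_rev]
      exact abs_norm_sub_norm_le z x
    have := H (‖y‖ / ‖x‖) (‖x + y‖ / ‖x‖) (‖x - y‖ / ‖x‖) (by positivity) (by positivity)
      (bound _ (by simp)) (bound _ (by simp)) (by
        simp only [Real.div_rpow (norm_nonneg _) hn.le]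
        rw [← add_div, div_le_iff₀ hpn]
        refine (hX x y).trans_eq ?_
        field_simp)
    simp only [Real.div_rpow (norm_nonneg _) hn.le] at this
    rw [← add_div, div_le_iff₀ hrn] at this
    refine this.trans_eq ?_
    rw [Real.rpow_sub hn]
    field_simp

theorem exists_rpow_drift_le {p r C B : ℝ} (hp1 : 1 < p) (hp2 : p ≤ 2) (hr : p ≤ r)
    (hC : 0 ≤ C) (hB : 0 ≤ B)
    (hX : ∀ x y : X, ‖x + y‖ ^ p + ‖x - y‖ ^ p ≤ 2 * ‖x‖ ^ p + C * ‖y‖ ^ p) :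
    ∃ L, 1 ≤ L ∧ ∀ (x y : X) (s : ℝ), 0 ≤ s →
      B * (‖x + y‖ ^ r + ‖x - y‖ ^ r) + (L * s + ‖x + y‖ ^ p) ^ (r / p) ≤
        2 * B * ‖x‖ ^ r + (L * (s + ‖y‖ ^ p) + ‖x + y‖ ^ p) ^ (r / p) := by
  obtain ⟨K, hK, H⟩ := exists_norm_add_rpow_add_norm_sub_rpow_le hp1 hp2 hr hC hX
  have hp0 : 0 < p := by linarith
  have hα : 1 ≤ r / p := (one_le_div hp0).2 hr
  set D : ℝ := 2 ^ (r - p) with hD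
  have hD0 : 0 < D := by positivity
  set L : ℝ := max 1 (2 * (B * (K * (D + 1)))) with hL
  have hL1 : 1 ≤ L := le_max_left _ _
  have hL2 : 2 * (B * (K * (D + 1))) ≤ L := le_max_right _ _
  refine ⟨L, hL1, fun x y s hs => ?_⟩
  set u := ‖x + y‖ with hu
  have hu0 : 0 ≤ u := norm_nonneg _
  have hy0 : 0 ≤ ‖y‖ := norm_nonneg _
  have hyr : ‖y‖ ^ (r - p) * ‖y‖ ^ p = ‖y‖ ^ r := by
    rw [← Real.rpow_add_of_nonneg hy0 (by linarith) hp0.le]; simp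
  have hx : ‖x‖ ^ (r - p) ≤ D * (u ^ (r - p) + ‖y‖ ^ (r - p)) := by
    have hxy : ‖x‖ ≤ 2 * max u ‖y‖ := by
      have : ‖x‖ ≤ u + ‖y‖ := by simpa using norm_sub_le (x + y) y
      linarith [le_max_left u ‖y‖, le_max_right u ‖y‖]
    refine (Real.rpow_le_rpow (norm_nonneg x) hxy (by linarith)).trans ?_
    rw [Real.mul_rpow (by norm_num) (by positivity)]
    refine mul_le_mul_of_nonneg_left ?_ hD0.le
    rcases max_cases u ‖y‖ with ⟨e, _⟩ | ⟨e, _⟩ <;> rw [e]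
    · linarith [Real.rpow_nonneg hy0 (r - p)]
    · linarith [Real.rpow_nonneg hu0 (r - p)]
  have hx' : ‖x‖ ^ (r - p) * ‖y‖ ^ p + ‖y‖ ^ r ≤
      (D + 1) * (u ^ (r - p) * ‖y‖ ^ p + ‖y‖ ^ r) := by
    have h1 := mul_le_mul_of_nonneg_right hx (Real.rpow_nonneg hy0 p)
    rw [mul_add, add_mul, mul_assoc, mul_assoc, hyr] at h1
    have h2 : 0 ≤ u ^ (r - p) * ‖y‖ ^ p := by positivity
    linarith
  have hgain := Real.rpow_add_drift_le hα (a := L * s + u ^ p) (b := L * ‖y‖ ^ p)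
    (by positivity) (by positivity)
  have g1 : u ^ (r - p) ≤ (L * s + u ^ p) ^ (r / p - 1) := by
    have : u ^ (r - p) = (u ^ p) ^ (r / p - 1) := by
      rw [← Real.rpow_mul hu0]; congr 1; field_simp
    rw [this]
    have : 0 ≤ L * s := by positivity
    exact Real.rpow_le_rpow (by positivity) (by linarith) (by linarith)
  have g2 : L * ‖y‖ ^ r ≤ (L * ‖y‖ ^ p) ^ (r / p) := by
    rw [Real.mul_rpow (by positivity) (by positivity), ← Real.rpow_mul hy0,
      mul_div_cancel₀ _ hp0.ne']
    gcongr
    simpa using Real.rpow_le_rpow_of_exponent_le hL1 hα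
  have g3 : L * ‖y‖ ^ p * u ^ (r - p) ≤ L * ‖y‖ ^ p * (L * s + u ^ p) ^ (r / p - 1) :=
    mul_le_mul_of_nonneg_left g1 (by positivity)
  have h1 := mul_le_mul_of_nonneg_left (H x y) hB
  have h2 := mul_le_mul_of_nonneg_left hx' (by positivity : 0 ≤ B * K)
  have h3 := mul_le_mul_of_nonneg_right hL2
    (by positivity : 0 ≤ u ^ (r - p) * ‖y‖ ^ p + ‖y‖ ^ r)
  have e : L * (s + ‖y‖ ^ p) + u ^ p = L * s + u ^ p + L * ‖y‖ ^ p := by ring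
  rw [e]
  linarith

end Smooth
section Integrability

variable {X Ω : Type*} [NormedAddCommGroup X] {mΩ : MeasurableSpace Ω} {μ : Measure Ω}

theorem MeasureTheory.memLp_ofReal_iff_integrable_norm_rpow {f : Ω → X} {r : ℝ} (hr : 0 < r)
    (hf : AEStronglyMeasurable f μ) :
    MemLp f (ENNReal.ofReal r) μ ↔ Integrable (fun ω => ‖f ω‖ ^ r) μ := by
  rw [← integrable_norm_rpow_iff hf (by simpa using hr) (by simp), ENNReal.toReal_ofReal hr.le]

theorem MeasureTheory.memLp_ofReal_iff_integrable_rpow {f : Ω → ℝ} {r : ℝ} (hr : 0 < r)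
    (hf : AEStronglyMeasurable f μ) (hf0 : ∀ ω, 0 ≤ f ω) :
    MemLp f (ENNReal.ofReal r) μ ↔ Integrable (fun ω => f ω ^ r) μ := by
  simp [memLp_ofReal_iff_integrable_norm_rpow hr hf, fun ω => abs_of_nonneg (hf0 ω)]

theorem MeasureTheory.memLp_norm_rpow_ofReal_div_iff {f : Ω → X} {p r : ℝ} (hp : 0 < p)
    (hf : AEStronglyMeasurable f μ) :
    MemLp (fun ω => ‖f ω‖ ^ p) (ENNReal.ofReal (r / p)) μ ↔ MemLp f (ENNReal.ofReal r) μ := by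
  rw [ENNReal.ofReal_div_of_pos hp, ← memLp_norm_rpow_iff (q := ENNReal.ofReal p) hf
    (by simpa using hp) (by simp), ENNReal.toReal_ofReal hp.le]

end Integrability

section Jensen

variable {X Ω : Type*} [NormedAddCommGroup X] [NormedSpace ℝ X] [CompleteSpace X]
  {m mΩ : MeasurableSpace Ω} {μ : Measure Ω} [IsFiniteMeasure μ]

theorem MeasureTheory.integral_add_norm_condExp_rpow_le {p r : ℝ} (hp : 1 ≤ p) (hr : 1 ≤ r)
    (hm : m ≤ mΩ) {s : Ω → ℝ} (hs : StronglyMeasurable[m] s) (hs0 : ∀ ω, 0 ≤ s ω)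
    (hsr : MemLp s (ENNReal.ofReal (r / p)) μ) {f : Ω → X} (hf : MemLp f (ENNReal.ofReal r) μ) :
    ∫ ω, (s ω + ‖(μ[f | m]) ω‖ ^ p) ^ (r / p) ∂μ ≤ ∫ ω, (s ω + ‖f ω‖ ^ p) ^ (r / p) ∂μ := by
  have hp0 : 0 < p := by linarith
  have hr0 : 0 < r := by linarith
  set q := ENNReal.ofReal p with hq
  have : Fact (1 ≤ q) := ⟨by simpa [hq] using hp⟩
  have hqp : q.toReal = p := ENNReal.toReal_ofReal hp0.le
  have h1r : 1 ≤ ENNReal.ofReal r := by simpa using hr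
  have hsm : StronglyMeasurable[m] fun ω => s ω ^ (1 / p) :=
    (hs.measurable.pow_const _).stronglyMeasurable
  have hs' : MemLp (fun ω => s ω ^ (1 / p)) (ENNReal.ofReal r) μ := by
    rw [← memLp_norm_rpow_ofReal_div_iff hp0 (hsm.mono hm).aestronglyMeasurable]
    refine hsr.congr_norm ?_ (Filter.Eventually.of_forall fun ω => ?_)
    · exact ((((hsm.mono hm).measurable.norm).pow_const _)).aestronglyMeasurable
    · rw [Real.norm_of_nonneg (Real.rpow_nonneg (hs0 ω) _), ← Real.rpow_mul (hs0 ω),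
        one_div_mul_cancel hp0.ne', Real.rpow_one]
  let e := (WithLp.prodContinuousLinearEquiv q ℝ ℝ X).symm
  let g : Ω → WithLp q (ℝ × X) := fun ω => WithLp.toLp q (s ω ^ (1 / p), f ω)
  have norm_g : ∀ (a : ℝ) (x : X), 0 ≤ a →
      ‖(WithLp.toLp q (a ^ (1 / p), x) : WithLp q (ℝ × X))‖ ^ r = (a + ‖x‖ ^ p) ^ (r / p) := by
    intro a x ha
    rw [WithLp.prod_norm_eq_add (by rw [hqp]; exact hp0), hqp]
    simp only [WithLp.toLp_fst, WithLp.toLp_snd]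
    rw [Real.norm_of_nonneg (by positivity), ← Real.rpow_mul ha, one_div_mul_cancel hp0.ne',
      Real.rpow_one, ← Real.rpow_mul (by positivity), one_div_mul_eq_div]
  have hgint : Integrable g μ :=
    (e : ℝ × X →L[ℝ] WithLp q (ℝ × X)).integrable_comp
      ((hs'.integrable h1r).prodMk (hf.integrable h1r))
  have hgr : Integrable (fun ω => ‖g ω‖ ^ r) μ := by
    simp only [g, norm_g _ _ (hs0 _)]
    rw [← memLp_ofReal_iff_integrable_rpow (div_pos hr0 hp0)]
    · exact hsr.add ((memLp_norm_rpow_ofReal_div_iff hp0 hf.1).2 hf)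
    · exact (hsr.add ((memLp_norm_rpow_ofReal_div_iff hp0 hf.1).2 hf)).1
    · intro ω
      have := hs0 ω
      positivity
  have hJ := integral_norm_condExp_rpow_le (m := m) hr hgr
  have h1 := (WithLp.fstL q ℝ ℝ X).comp_condExp_comm (m := m) hgint
  have h2 := (WithLp.sndL q ℝ ℝ X).comp_condExp_comm (m := m) hgint
  have h1' : μ[WithLp.fstL q ℝ ℝ X ∘ g | m] = fun ω => s ω ^ (1 / p) :=
    condExp_of_stronglyMeasurable hm hsm (hs'.integrable h1r)
  have h2' : WithLp.sndL q ℝ ℝ X ∘ g = f := rfl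
  rw [h1'] at h1
  rw [h2'] at h2
  have hL : (fun ω => ‖(μ[g | m]) ω‖ ^ r) =ᵐ[μ]
      fun ω => (s ω + ‖(μ[f | m]) ω‖ ^ p) ^ (r / p) := by
    filter_upwards [h1, h2] with ω a b
    rw [← norm_g _ _ (hs0 ω), ← a, ← b]
    rfl
  rw [integral_congr_ae hL] at hJ
  simpa only [g, norm_g _ _ (hs0 _)] using hJ

end Jensen

section Sums

variable {X Ω : Type*} [NormedAddCommGroup X] {mΩ : MeasurableSpace Ω} {μ : Measure Ω}
  {d : ℕ → Ω → X}

theorem memLp_sum_norm_rpow {p r : ℝ} (hp : 0 < p) {n : ℕ}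
    (hd : ∀ k ∈ Icc 1 n, MemLp (d k) (ENNReal.ofReal r) μ) :
    MemLp (fun ω => ∑ k ∈ Icc 1 n, ‖d k ω‖ ^ p) (ENNReal.ofReal (r / p)) μ :=
  memLp_finsetSum _ fun k hk => (memLp_norm_rpow_ofReal_div_iff hp (hd k hk).1).2 (hd k hk)

theorem sum_norm_rpow_nonneg (p : ℝ) (n : ℕ) (ω : Ω) : 0 ≤ ∑ k ∈ Icc 1 n, ‖d k ω‖ ^ p :=
  Finset.sum_nonneg fun _ _ => by positivity

theorem integrable_mul_sum_add_norm_rpow {p r L : ℝ} (hp : 0 < p) (hr : 0 < r) (hL : 0 ≤ L)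
    {n : ℕ} (hd : ∀ k ∈ Icc 1 n, MemLp (d k) (ENNReal.ofReal r) μ) {f : Ω → X}
    (hf : MemLp f (ENNReal.ofReal r) μ) :
    Integrable (fun ω => (L * ∑ k ∈ Icc 1 n, ‖d k ω‖ ^ p + ‖f ω‖ ^ p) ^ (r / p)) μ := by
  have h := ((memLp_sum_norm_rpow hp hd).const_mul L).add
    ((memLp_norm_rpow_ofReal_div_iff hp hf.1).2 hf)
  refine (memLp_ofReal_iff_integrable_rpow (div_pos hr hp) h.1 fun ω => ?_).1 h
  have := sum_norm_rpow_nonneg (d := d) p n ω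
  simp only [Pi.add_apply]
  positivity

end Sums

section Adapted

variable {X Ω : Type*} [NormedAddCommGroup X] [NormedSpace ℝ X] {mΩ : MeasurableSpace Ω}
  {μ : Measure Ω} {ℱ : Filtration ℕ mΩ} {d : ℕ → Ω → X}

theorem MeasureTheory.Martingale.stronglyMeasurable_of_sum_Icc
    (hM : Martingale (fun m => ∑ k ∈ Icc 1 m, d k) ℱ μ) {k : ℕ} (hk : 1 ≤ k) :
    StronglyMeasurable[ℱ k] (d k) := by
  obtain ⟨j, rfl⟩ : ∃ j, k = j + 1 := ⟨k - 1, by omega⟩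
  have := (hM.1 (j + 1)).sub ((hM.1 j).mono (ℱ.mono (Nat.le_succ j)))
  simpa [Finset.sum_Icc_succ_top] using this

theorem MeasureTheory.Martingale.stronglyMeasurable_sum_norm_rpow
    (hM : Martingale (fun m => ∑ k ∈ Icc 1 m, d k) ℱ μ) (p : ℝ) (n : ℕ) :
    StronglyMeasurable[ℱ n] fun ω => ∑ k ∈ Icc 1 n, ‖d k ω‖ ^ p :=
  Finset.stronglyMeasurable_fun_sum _ fun _ hk =>
    (((hM.stronglyMeasurable_of_sum_Icc (mem_Icc.1 hk).1).mono
      (ℱ.mono (mem_Icc.1 hk).2)).norm.measurable.pow_const p).stronglyMeasurable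

theorem MeasureTheory.Martingale.memLp_of_sum_Icc [CompleteSpace X]
    (hM : Martingale (fun m => ∑ k ∈ Icc 1 m, d k) ℱ μ) {q : ENNReal} (hq : 1 ≤ q) {n : ℕ}
    (hn : MemLp (∑ k ∈ Icc 1 n, d k) q μ) {k : ℕ} (hk : k ∈ Icc 1 n) : MemLp (d k) q μ := by
  have h : ∀ j ≤ n, MemLp (∑ k ∈ Icc 1 j, d k) q μ := fun j hj =>
    (memLp_congr_ae (hM.condExp_ae_eq hj)).1 (hn.condExp hq)
  obtain ⟨hk1, hkn⟩ := mem_Icc.1 hk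
  obtain ⟨j, rfl⟩ : ∃ j, k = j + 1 := ⟨k - 1, by omega⟩
  have := (h (j + 1) hkn).sub (h j (by omega))
  simpa [Finset.sum_Icc_succ_top] using this

end Adapted

section Martingale

variable {X Ω : Type*} [NormedAddCommGroup X] [NormedSpace ℝ X] [CompleteSpace X]
  {mΩ : MeasurableSpace Ω} {μ : Measure Ω} [IsFiniteMeasure μ] {ℱ : Filtration ℕ mΩ}
  {d : ℕ → Ω → X}

theorem MeasureTheory.Martingale.integral_add_norm_rpow_le {M : ℕ → Ω → X} (hM : Martingale M ℱ μ)
    {p r : ℝ} (hp : 1 ≤ p) (hr : 1 ≤ r) {k : ℕ} {s : Ω → ℝ} (hs : StronglyMeasurable[ℱ k] s)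
    (hs0 : ∀ ω, 0 ≤ s ω) (hsr : MemLp s (ENNReal.ofReal (r / p)) μ) (c : ℝ)
    (hMk : MemLp (M k) (ENNReal.ofReal r) μ) (hMk' : MemLp (M (k + 1)) (ENNReal.ofReal r) μ) :
    ∫ ω, (s ω + ‖M k ω‖ ^ p) ^ (r / p) ∂μ ≤
      ∫ ω, (s ω + ‖M k ω + c • (M (k + 1) ω - M k ω)‖ ^ p) ^ (r / p) ∂μ := by
  have hf : MemLp (M k + c • (M (k + 1) - M k)) (ENNReal.ofReal r) μ :=
    hMk.add ((hMk'.sub hMk).const_smul c)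
  have hc : μ[M k + c • (M (k + 1) - M k) | ℱ k] =ᵐ[μ] M k := by
    have i₁ := hM.integrable k
    have i₂ := hM.integrable (k + 1)
    filter_upwards [condExp_add i₁ ((i₂.sub i₁).smul c) (ℱ k),
      condExp_smul c (M (k + 1) - M k) (ℱ k), condExp_sub i₂ i₁ (ℱ k),
      hM.condExp_ae_eq (Nat.le_succ k), hM.condExp_ae_eq (le_refl k)] with ω a b c d e
    rw [a, Pi.add_apply, b, Pi.smul_apply, c, Pi.sub_apply, d, e]
    simp
  refine le_of_eq_of_le (integral_congr_ae ?_)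
    (integral_add_norm_condExp_rpow_le hp hr (ℱ.le k) hs hs0 hsr hf)
  filter_upwards [hc] with ω h
  rw [← h]
  rfl

theorem integral_norm_sum_rpow_le_of_le {p r C : ℝ} (hp1 : 1 < p) (hr : 1 ≤ r) (hrp : r ≤ p)
    (hC : 2 ≤ C)
    (hX : ∀ x y : X, ‖x + y‖ ^ p + ‖x - y‖ ^ p ≤ 2 * ‖x‖ ^ p + C * ‖y‖ ^ p)
    (hM : Martingale (fun m => ∑ k ∈ Icc 1 m, d k) ℱ μ) (n : ℕ)
    (hd : ∀ k ∈ Icc 1 n, MemLp (d k) (ENNReal.ofReal r) μ) :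
    ∫ ω, ‖∑ k ∈ Icc 1 n, d k ω‖ ^ r ∂μ ≤
      (C + 1) * ∫ ω, (∑ k ∈ Icc 1 n, ‖d k ω‖ ^ p) ^ (r / p) ∂μ := by
  have hp0 : 0 < p := by linarith
  have hr0 : 0 < r := by linarith
  have hα0 : 0 < r / p := div_pos hr0 hp0
  have hα1 : r / p ≤ 1 := (div_le_one hp0).2 hrp
  have hMem : ∀ n, (∀ k ∈ Icc 1 n, MemLp (d k) (ENNReal.ofReal r) μ) →
      MemLp (fun ω => ∑ k ∈ Icc 1 n, d k ω) (ENNReal.ofReal r) μ :=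
    fun n h => memLp_finsetSum _ h
  have hS : ∀ n, (∀ k ∈ Icc 1 n, MemLp (d k) (ENNReal.ofReal r) μ) →
      Integrable (fun ω => (∑ k ∈ Icc 1 n, ‖d k ω‖ ^ p) ^ (r / p)) μ := fun n h =>
    (memLp_ofReal_iff_integrable_rpow hα0 (memLp_sum_norm_rpow hp0 h).1
      (sum_norm_rpow_nonneg p n)).1 (memLp_sum_norm_rpow hp0 h)
  have hInt : ∀ n, (∀ k ∈ Icc 1 n, MemLp (d k) (ENNReal.ofReal r) μ) → ∀ f : Ω → X,
      MemLp f (ENNReal.ofReal r) μ →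
      Integrable (fun ω => (∑ k ∈ Icc 1 n, ‖d k ω‖ ^ p + ‖f ω‖ ^ p) ^ (r / p)) μ :=
    fun n h f hf => by simpa using integrable_mul_sum_add_norm_rpow hp0 hr0 zero_le_one h hf
  have key : ∫ ω, (∑ k ∈ Icc 1 n, ‖d k ω‖ ^ p + ‖∑ k ∈ Icc 1 n, d k ω‖ ^ p) ^ (r / p) ∂μ ≤
      (C + 1) * ∫ ω, (∑ k ∈ Icc 1 n, ‖d k ω‖ ^ p) ^ (r / p) ∂μ := by
    induction n with
    | zero => simp [Real.zero_rpow hp0.ne', Real.zero_rpow hα0.ne']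
    | succ n ih =>
      have hd' : ∀ k ∈ Icc 1 n, MemLp (d k) (ENNReal.ofReal r) μ := fun k hk =>
        hd k (Icc_subset_Icc_right (Nat.le_succ n) hk)
      have hdn : MemLp (d (n + 1)) (ENNReal.ofReal r) μ := hd _ (by simp)
      have J := hM.integral_add_norm_rpow_le hp1.le hr (k := n)
        (hM.stronglyMeasurable_sum_norm_rpow p n) (sum_norm_rpow_nonneg p n)
        (memLp_sum_norm_rpow hp0 hd') (-1) (memLp_finsetSum' _ hd') (memLp_finsetSum' _ hd)
      simp only [Finset.sum_apply, Finset.sum_Icc_succ_top (Nat.le_add_left 1 n),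
        add_sub_cancel_left, neg_one_smul, ← sub_eq_add_neg] at J
      have I₁ := hInt (n + 1) hd _ (hMem (n + 1) hd)
      have I₂ := hInt n hd' _ ((hMem n hd').sub hdn)
      have I₃ := hInt n hd' _ (hMem n hd')
      have I₄ := hS (n + 1) hd
      have I₅ := hS n hd'
      have P := integral_mono (I₁.add I₂) ((I₃.const_mul 2).add ((I₄.sub I₅).const_mul (C + 1)))
        fun ω => by
          have := Real.rpow_drift_le_of_le_one hα0.le hα1 hC
            (sum_norm_rpow_nonneg (d := d) p n ω)
            (by positivity) (by positivity) (by positivity) (by positivity)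
            (hX (∑ k ∈ Icc 1 n, d k ω) (d (n + 1) ω))
          simpa only [Finset.sum_Icc_succ_top (Nat.le_add_left 1 n), Pi.add_apply, Pi.sub_apply]
            using this
      rw [integral_add' I₁ I₂, integral_add' (I₃.const_mul 2) ((I₄.sub I₅).const_mul (C + 1)),
        integral_const_mul, integral_const_mul, integral_sub' I₄ I₅] at P
      have := ih hd'
      simp only [Pi.sub_apply] at P
      linarith
  refine (integral_mono ((memLp_ofReal_iff_integrable_norm_rpow hr0 (hMem n hd).1).1 (hMem n hd))
    (hInt n hd _ (hMem n hd)) fun ω => ?_).trans key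
  have h0 := sum_norm_rpow_nonneg (d := d) p n ω
  calc ‖∑ k ∈ Icc 1 n, d k ω‖ ^ r = (‖∑ k ∈ Icc 1 n, d k ω‖ ^ p) ^ (r / p) := by
        rw [← Real.rpow_mul (norm_nonneg _), mul_div_cancel₀ _ hp0.ne']
    _ ≤ _ := Real.rpow_le_rpow (by positivity) (by linarith) hα0.le

theorem exists_integral_norm_sum_rpow_le_of_ge {p r C : ℝ} (hp1 : 1 < p) (hp2 : p ≤ 2)
    (hpr : p ≤ r) (hC : 0 ≤ C)
    (hX : ∀ x y : X, ‖x + y‖ ^ p + ‖x - y‖ ^ p ≤ 2 * ‖x‖ ^ p + C * ‖y‖ ^ p) :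
    ∃ K > 0, ∀ {Ω : Type*} {mΩ : MeasurableSpace Ω} {μ : Measure Ω} [IsFiniteMeasure μ]
      {ℱ : Filtration ℕ mΩ} {d : ℕ → Ω → X},
      Martingale (fun m => ∑ k ∈ Icc 1 m, d k) ℱ μ → ∀ n : ℕ,
      (∀ k ∈ Icc 1 n, MemLp (d k) (ENNReal.ofReal r) μ) →
      ∫ ω, ‖∑ k ∈ Icc 1 n, d k ω‖ ^ r ∂μ ≤
        K * ∫ ω, (∑ k ∈ Icc 1 n, ‖d k ω‖ ^ p) ^ (r / p) ∂μ := by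
  have hp0 : 0 < p := by linarith
  have hr0 : 0 < r := by linarith
  have hα0 : 0 < r / p := div_pos hr0 hp0
  obtain ⟨L, hL1, hL⟩ := exists_rpow_drift_le (B := 2 * 2 ^ (r / p)) hp1 hp2 hpr hC
    (by positivity) hX
  have hL0 : 0 < L := by linarith
  refine ⟨L ^ (r / p), by positivity, fun {Ω mΩ μ _ ℱ d} hM n hd => ?_⟩
  have hMem : ∀ n, (∀ k ∈ Icc 1 n, MemLp (d k) (ENNReal.ofReal r) μ) →
      MemLp (fun ω => ∑ k ∈ Icc 1 n, d k ω) (ENNReal.ofReal r) μ :=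
    fun n h => memLp_finsetSum _ h
  have hS : Integrable (fun ω => (∑ k ∈ Icc 1 n, ‖d k ω‖ ^ p) ^ (r / p)) μ :=
    (memLp_ofReal_iff_integrable_rpow hα0 (memLp_sum_norm_rpow hp0 hd).1
      (sum_norm_rpow_nonneg p n)).1 (memLp_sum_norm_rpow hp0 hd)
  have hN : ∀ f : Ω → X, MemLp f (ENNReal.ofReal r) μ → Integrable (fun ω => ‖f ω‖ ^ r) μ :=
    fun f hf => (memLp_ofReal_iff_integrable_norm_rpow hr0 hf.1).1 hf
  have key : 2 * 2 ^ (r / p) * ∫ ω, ‖∑ k ∈ Icc 1 n, d k ω‖ ^ r ∂μ ≤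
      ∫ ω, (L * ∑ k ∈ Icc 1 n, ‖d k ω‖ ^ p + ‖∑ k ∈ Icc 1 n, d k ω‖ ^ p) ^ (r / p) ∂μ := by
    clear hS
    induction n with
    | zero => simp [Real.zero_rpow hp0.ne', Real.zero_rpow hα0.ne', Real.zero_rpow hr0.ne']
    | succ n ih =>
      have hd' : ∀ k ∈ Icc 1 n, MemLp (d k) (ENNReal.ofReal r) μ := fun k hk =>
        hd k (Icc_subset_Icc_right (Nat.le_succ n) hk)
      have hdn : MemLp (d (n + 1)) (ENNReal.ofReal r) μ := hd _ (by simp)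
      have J₁ := hM.integral_add_norm_rpow_le hp1.le (hp1.le.trans hpr) (k := n)
        ((hM.stronglyMeasurable_sum_norm_rpow p n).const_mul L)
        (fun ω => mul_nonneg hL0.le (sum_norm_rpow_nonneg p n ω))
        ((memLp_sum_norm_rpow hp0 hd').const_mul L) 1
        (memLp_finsetSum' _ hd') (memLp_finsetSum' _ hd)
      have J₂ := hM.integral_add_norm_rpow_le hp1.le (hp1.le.trans hpr) (k := n)
        (s := fun _ => 0) stronglyMeasurable_const (fun _ => le_rfl) MemLp.zero' (-1)
        (memLp_finsetSum' _ hd') (memLp_finsetSum' _ hd)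
      simp only [Finset.sum_apply, Finset.sum_Icc_succ_top (Nat.le_add_left 1 n),
        add_sub_cancel_left, one_smul, neg_one_smul, ← sub_eq_add_neg, zero_add,
        ← Real.rpow_mul (norm_nonneg _), mul_div_cancel₀ _ hp0.ne'] at J₁ J₂
      have I₁ := hN _ ((hMem n hd').add hdn)
      have I₂ := hN _ ((hMem n hd').sub hdn)
      have I₃ := hN _ (hMem n hd')
      have I₄ := integrable_mul_sum_add_norm_rpow hp0 hr0 hL0.le hd (hMem _ hd)
      have I₅ := integrable_mul_sum_add_norm_rpow hp0 hr0 hL0.le hd' ((hMem n hd').add hdn)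
      simp only [Finset.sum_Icc_succ_top (Nat.le_add_left 1 n)] at I₄
      have P := integral_mono (((I₁.add I₂).const_mul (2 * 2 ^ (r / p))).add I₅)
        ((I₃.const_mul (2 * (2 * 2 ^ (r / p)))).add I₄)
        (fun ω => hL (∑ k ∈ Icc 1 n, d k ω) (d (n + 1) ω) _ (sum_norm_rpow_nonneg p n ω))
      rw [integral_add' ((I₁.add I₂).const_mul (2 * 2 ^ (r / p))) I₅,
        integral_add' (I₃.const_mul (2 * (2 * 2 ^ (r / p)))) I₄,
        integral_const_mul, integral_const_mul, integral_add' I₁ I₂] at P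
      simp only [Pi.add_apply, Pi.sub_apply] at P
      have Q := ih hd'
      have R := mul_le_mul_of_nonneg_left J₂ (by positivity : (0 : ℝ) ≤ 2 * 2 ^ (r / p))
      simp only [Finset.sum_Icc_succ_top (Nat.le_add_left 1 n)]
      linarith
  have up := integral_mono (integrable_mul_sum_add_norm_rpow hp0 hr0 hL0.le hd (hMem n hd))
    (((hS.const_mul (L ^ (r / p))).add (hN _ (hMem n hd))).const_mul (2 ^ (r / p))) fun ω => by
      have h0 := sum_norm_rpow_nonneg (d := d) p n ω
      set a := L * ∑ k ∈ Icc 1 n, ‖d k ω‖ ^ p with ha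
      set b := ‖∑ k ∈ Icc 1 n, d k ω‖ ^ p with hb
      have ha0 : 0 ≤ a := by positivity
      have hb0 : 0 ≤ b := by positivity
      have e₁ : L ^ (r / p) * (∑ k ∈ Icc 1 n, ‖d k ω‖ ^ p) ^ (r / p) = a ^ (r / p) := by
        rw [ha, Real.mul_rpow hL0.le h0]
      have e₂ : ‖∑ k ∈ Icc 1 n, d k ω‖ ^ r = b ^ (r / p) := by
        rw [hb, ← Real.rpow_mul (norm_nonneg _), mul_div_cancel₀ _ hp0.ne']
      simp only [Pi.add_apply]
      rw [e₁, e₂]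
      have hmax : a + b ≤ 2 * max a b := by linarith [le_max_left a b, le_max_right a b]
      refine (Real.rpow_le_rpow (by positivity) hmax hα0.le).trans ?_
      rw [Real.mul_rpow (by norm_num) (le_max_of_le_left ha0)]
      refine mul_le_mul_of_nonneg_left ?_ (by positivity)
      rcases max_cases a b with ⟨e, _⟩ | ⟨e, _⟩ <;> rw [e]
      · linarith [Real.rpow_nonneg hb0 (r / p)]
      · linarith [Real.rpow_nonneg ha0 (r / p)]
  rw [integral_const_mul, integral_add' (hS.const_mul _) (hN _ (hMem n hd)),
    integral_const_mul] at up
  have h2 : (0 : ℝ) < 2 ^ (r / p) := by positivity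
  have := key.trans up
  rw [mul_comm 2, mul_assoc] at this
  linarith [le_of_mul_le_mul_left this h2]

end Martingale

/-- Burkholder-type inequality in `p`-smooth Banach spaces: for a martingale
`μ_m = ∑_{k=1}^m d_k`, `E‖μ_n‖^r ≤ C(X, r, p) · E(∑_{k=1}^n ‖d_k‖^p)^{r/p}`. -/
theorem burkholder_p_smooth
    {X : Type*} [NormedAddCommGroup X] [NormedSpace ℝ X] [CompleteSpace X]
    (p : ℝ) (hp1 : 1 < p) (hp2 : p ≤ 2)
    (hsmooth : ∃ C₀ > 0, ∀ x y : X,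
      ‖x + y‖ ^ p + ‖x - y‖ ^ p ≤ 2 * ‖x‖ ^ p + C₀ * ‖y‖ ^ p)
    (r : ℝ) (hr : 1 ≤ r) :
    ∃ C > 0, ∀ (Ω : Type) (mΩ : MeasurableSpace Ω) (μ : Measure Ω),
      IsProbabilityMeasure μ →
      ∀ (ℱ : Filtration ℕ mΩ) (d : ℕ → Ω → X) (n : ℕ),
        Martingale (fun m => ∑ k ∈ Finset.Icc 1 m, d k) ℱ μ →
        (∫ ω, ‖∑ k ∈ Finset.Icc 1 n, d k ω‖ ^ r ∂μ) ≤
          C * ∫ ω, (∑ k ∈ Finset.Icc 1 n, ‖d k ω‖ ^ p) ^ (r / p) ∂μ := by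
  obtain ⟨C₀, hC₀, hX⟩ := hsmooth
  have hp0 : 0 < p := by linarith
  have hr0 : 0 < r := by linarith
  have hα0 : 0 < r / p := div_pos hr0 hp0
  suffices h : ∃ C > 0, ∀ (Ω : Type) (mΩ : MeasurableSpace Ω) (μ : Measure Ω),
      IsProbabilityMeasure μ → ∀ (ℱ : Filtration ℕ mΩ) (d : ℕ → Ω → X) (n : ℕ),
        Martingale (fun m => ∑ k ∈ Finset.Icc 1 m, d k) ℱ μ →
        (∀ k ∈ Icc 1 n, MemLp (d k) (ENNReal.ofReal r) μ) →
        (∫ ω, ‖∑ k ∈ Finset.Icc 1 n, d k ω‖ ^ r ∂μ) ≤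
          C * ∫ ω, (∑ k ∈ Finset.Icc 1 n, ‖d k ω‖ ^ p) ^ (r / p) ∂μ by
    obtain ⟨C, hC, H⟩ := h
    refine ⟨C, hC, fun Ω mΩ μ hμ ℱ d n hM => ?_⟩
    by_cases hd : ∀ k ∈ Icc 1 n, MemLp (d k) (ENNReal.ofReal r) μ
    · exact H Ω mΩ μ hμ ℱ d n hM hd
    · have hn : ¬ Integrable (fun ω => ‖∑ k ∈ Icc 1 n, d k ω‖ ^ r) μ := fun hI => hd fun k hk => by
        have hmeas := ((hM.1 n).mono (ℱ.le n)).aestronglyMeasurable (μ := μ)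
        refine hM.memLp_of_sum_Icc (by simpa using hr) ?_ hk
        refine (memLp_ofReal_iff_integrable_norm_rpow hr0 hmeas).2 ?_
        simpa only [Finset.sum_apply] using hI
      rw [integral_undef hn]
      exact mul_nonneg hC.le (integral_nonneg fun ω =>
        Real.rpow_nonneg (sum_norm_rpow_nonneg p n ω) _)
  rcases le_total r p with hrp | hpr
  · refine ⟨max C₀ 2 + 1, by positivity, fun Ω mΩ μ hμ ℱ d n hM hd => ?_⟩
    refine integral_norm_sum_rpow_le_of_le hp1 hr hrp (le_max_right _ _) (fun x y => ?_) hM n hd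
    refine (hX x y).trans ?_
    gcongr
    exact le_max_left _ _
  · obtain ⟨K, hK, H⟩ := exists_integral_norm_sum_rpow_le_of_ge hp1 hp2 hpr hC₀.le hX
    exact ⟨K, hK, fun Ω mΩ μ hμ ℱ d n hM hd => H hM n hd⟩
end
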